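/- arXiv:1702.00859 — 4 statements merged into one kernel-verified Lean document; each statement's English description precedes it below -/
import Mathlib

section
/- There exist universal constants c, C > 0 and n₀ ∈ ℕ with the following property: for every n ≥ n₀ there is an origin-symmetric convex body B ⊂ ℝⁿ in John's position, such that the standard basis of ℝⁿ is 1-unconditional for ‖·‖_B, and such that for every ε ∈ (0, c] and every natural number k ≥ C·max(ε²·log n, 1), the random k-dimensional subspace E distributed according to the rotation-invariant (Haar) measure satisfies P{B ∩ E is (1+ε)-Euclidean} ≤ 1/2. -/
open MeasureTheory ProbabilityTheory Real
open scoped ENNReal RealInnerProductSpace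

noncomputable section

/-- `ℝⁿ` with the Euclidean structure. -/
abbrev Euc (n : ℕ) := EuclideanSpace ℝ (Fin n)

/-- An origin-symmetric convex body in `ℝⁿ`: a compact convex set, symmetric about the
origin, with `0` in its interior. -/
def IsSymmConvexBody {n : ℕ} (B : Set (Euc n)) : Prop :=
  IsCompact B ∧ Convex ℝ B ∧ (0 : Euc n) ∈ interior B ∧ ∀ x ∈ B, -x ∈ B

/-- The standard Gaussian measure `γₙ` on `ℝⁿ`. -/
def stdGaussian (n : ℕ) : Measure (Euc n) :=
  (Measure.pi fun _ : Fin n => gaussianReal 0 1).map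
    ((EuclideanSpace.equiv (Fin n) ℝ).symm)

/-- `B` is in the ℓ-position: `ℓ(B, Id) = 1` (i.e. `E‖G‖_B² = 1`, where `‖·‖_B = gauge B`
is the Minkowski functional) and every linear operator `U` with `ℓ(B,U) ≤ 1` has
`|det U| ≤ 1`; together these say `sup{|det U| : ℓ(B,U) ≤ 1} = 1 = det Id`. -/
def IsEllPosition {n : ℕ} (B : Set (Euc n)) : Prop :=
  (∫ x, gauge B x ^ 2 ∂stdGaussian n) = 1 ∧
  ∀ U : Euc n →ₗ[ℝ] Euc n,
    (∫ x, gauge B (U x) ^ 2 ∂stdGaussian n) ≤ 1 → |LinearMap.det U| ≤ 1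

/-- `B` is in John's position: the Euclidean unit ball is contained in `B`, and every
ellipsoid (affine image of the unit ball) contained in `B` has volume at most that of the
unit ball, i.e. `|det T| ≤ 1`. -/
def IsJohnPosition {n : ℕ} (B : Set (Euc n)) : Prop :=
  Metric.closedBall (0 : Euc n) 1 ⊆ B ∧
  ∀ (T : Euc n →ₗ[ℝ] Euc n) (v : Euc n),
    (fun x => v + T x) '' Metric.closedBall (0 : Euc n) 1 ⊆ B → |LinearMap.det T| ≤ 1

/-- The standard basis of `ℝⁿ` is `1`-unconditional for `‖·‖_B`. -/
def StdUncond {n : ℕ} (B : Set (Euc n)) : Prop :=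
  ∀ (x σ : Fin n → ℝ), (∀ i, σ i = 1 ∨ σ i = -1) →
    gauge B ((EuclideanSpace.equiv (Fin n) ℝ).symm fun i => σ i * x i) =
      gauge B ((EuclideanSpace.equiv (Fin n) ℝ).symm x)

/-- The section `B ∩ E` is `(1+ε)`-Euclidean: there is an invertible linear image `𝓔` of
the Euclidean unit ball of `E` with `𝓔 ⊆ B ∩ E ⊆ (1+ε)𝓔`. -/
def IsEuclideanSection {n : ℕ} (B : Set (Euc n)) (E : Submodule ℝ (Euc n)) (ε : ℝ) : Prop :=
  ∃ T : E ≃ₗ[ℝ] E,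
    (⇑T '' {x : E | ‖(x : Euc n)‖ ≤ 1}) ⊆ {x : E | (x : Euc n) ∈ B} ∧
    {x : E | (x : Euc n) ∈ B} ⊆
      (fun y : E => (1 + ε) • y) '' (⇑T '' {x : E | ‖(x : Euc n)‖ ≤ 1})

/-- The cube intersected with the unit ball of the norm `a ‖x‖ + |x i₀| / 2`. -/
def truncatedCube {n : ℕ} (i₀ : Fin n) (a : ℝ) : Set (Euc n) :=
  {x | (∀ i, |x i| ≤ 1) ∧ a * ‖x‖ + |x i₀| / 2 ≤ 1}

lemma abs_coord_le_norm {n : ℕ} (x : Euc n) (i : Fin n) : |x i| ≤ ‖x‖ := by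
  simpa using PiLp.norm_apply_le x i

lemma closedBall_subset_truncatedCube {n : ℕ} (i₀ : Fin n) {a : ℝ} (ha : a ≤ 1 / 2) :
    Metric.closedBall (0 : Euc n) 1 ⊆ truncatedCube i₀ a := by
  intro x hx
  have hx' : ‖x‖ ≤ 1 := by simpa using hx
  refine ⟨fun i => (abs_coord_le_norm x i).trans hx', ?_⟩
  have := abs_coord_le_norm x i₀
  nlinarith [norm_nonneg x]

lemma isSymmConvexBody_truncatedCube {n : ℕ} (i₀ : Fin n) {a : ℝ} (ha0 : 0 < a)
    (ha : a ≤ 1 / 2) : IsSymmConvexBody (truncatedCube i₀ a) := by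
  refine ⟨?_, ?_, ?_, ?_⟩
  · refine Metric.isCompact_of_isClosed_isBounded ?_ ?_
    · have h1 : IsClosed {x : Euc n | ∀ i, |x i| ≤ 1} := by
        simp only [Set.ofPred_forall]
        exact isClosed_iInter fun i => isClosed_le (by fun_prop) continuous_const
      have h2 : IsClosed {x : Euc n | a * ‖x‖ + |x i₀| / 2 ≤ 1} :=
        isClosed_le (by fun_prop) continuous_const
      exact h1.inter h2
    · refine (Metric.isBounded_closedBall (x := (0 : Euc n)) (r := 1 / a)).subset ?_
      intro x hx
      have := hx.2
      have h3 := abs_nonneg (x i₀)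
      simp only [mem_closedBall_zero_iff]
      rw [le_div_iff₀ ha0]
      linarith
  · intro x hx y hy s t hs ht hst
    refine ⟨fun i => ?_, ?_⟩
    · have h1 := hx.1 i
      have h2 := hy.1 i
      simp only [PiLp.add_apply, PiLp.smul_apply, smul_eq_mul]
      rw [abs_le] at *
      constructor <;> nlinarith
    · have h1 := hx.2
      have h2 := hy.2
      have h3 : ‖s • x + t • y‖ ≤ s * ‖x‖ + t * ‖y‖ := by
        refine (norm_add_le _ _).trans ?_
        rw [norm_smul, norm_smul, Real.norm_of_nonneg hs, Real.norm_of_nonneg ht]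
      have h4 : |(s • x + t • y) i₀| ≤ s * |x i₀| + t * |y i₀| := by
        simp only [PiLp.add_apply, PiLp.smul_apply, smul_eq_mul]
        refine (abs_add_le _ _).trans ?_
        rw [abs_mul, abs_mul, abs_of_nonneg hs, abs_of_nonneg ht]
      have h5 := mul_le_mul_of_nonneg_left h3 ha0.le
      nlinarith
  · exact interior_mono (closedBall_subset_truncatedCube i₀ ha)
      (mem_interior_iff_mem_nhds.2 (Metric.closedBall_mem_nhds _ one_pos))
  · intro x hx
    exact ⟨fun i => by simpa using hx.1 i, by simpa using hx.2⟩

/-- Hadamard's inequality for a linear map of `ℝⁿ` mapping the unit ball into the cube. -/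
lemma abs_det_le_one_of_abs_coord_le {n : ℕ} (T : Euc n →ₗ[ℝ] Euc n)
    (hT : ∀ x, ‖x‖ ≤ 1 → ∀ i, |T x i| ≤ 1) : |LinearMap.det T| ≤ 1 := by
  set S := LinearMap.adjoint T with hS
  let e := EuclideanSpace.basisFun (Fin n) ℝ
  have hrow : ∀ i, ‖S (e i)‖ ≤ 1 := by
    intro i
    by_contra! h
    have h0 : 0 < ‖S (e i)‖ := by linarith
    have h1 := hT (‖S (e i)‖⁻¹ • S (e i)) (by
      rw [norm_smul, norm_inv, norm_norm, inv_mul_cancel₀ h0.ne']) i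
    have h2 : T (‖S (e i)‖⁻¹ • S (e i)) i = ‖S (e i)‖ := by
      have h3 : T (S (e i)) i = inner ℝ (e i) (T (S (e i))) := by
        simp [e, EuclideanSpace.inner_single_left]
      rw [map_smul, PiLp.smul_apply, h3, ← LinearMap.adjoint_inner_left,
        real_inner_self_eq_norm_sq, smul_eq_mul, ← hS]
      field_simp
    rw [h2, abs_of_pos h0] at h1
    linarith
  have hdet : |LinearMap.det S| ≤ 1 := by
    have : Fact (Module.finrank ℝ (Euc n) = n) := ⟨by simp⟩
    rcases n with _ | n
    · have : S = LinearMap.id := by ext x i; exact i.elim0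
      rw [this]; simp
    have h1 := Orientation.abs_volumeForm_apply_le e.toBasis.orientation (fun i => S (e i))
    rw [Orientation.volumeForm_robust _ e rfl] at h1
    have h2 : e.toBasis.det (fun i => S (e i)) = LinearMap.det S := by
      have := e.toBasis.det_comp S e
      rw [← e.coe_toBasis, Module.Basis.det_self, mul_one] at this
      exact this
    rw [h2] at h1
    exact h1.trans (Finset.prod_le_one (fun _ _ => norm_nonneg _) fun i _ => hrow i)
  have h3 : LinearMap.det S = LinearMap.det T := by
    rw [hS, ← LinearMap.det_toMatrix e.toBasis, ← LinearMap.det_toMatrix e.toBasis,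
      LinearMap.toMatrix_adjoint, Matrix.det_conjTranspose]
    simp
  rwa [h3] at hdet

lemma isJohnPosition_truncatedCube {n : ℕ} (i₀ : Fin n) {a : ℝ} (ha : a ≤ 1 / 2) :
    IsJohnPosition (truncatedCube i₀ a) := by
  refine ⟨closedBall_subset_truncatedCube i₀ ha, fun T v h => ?_⟩
  refine abs_det_le_one_of_abs_coord_le T fun x hx i => ?_
  have h1 := (h ⟨x, by simpa using hx, rfl⟩).1 i
  have h2 := (h ⟨-x, by simpa using hx, rfl⟩).1 i
  simp only [PiLp.add_apply, map_neg, PiLp.neg_apply] at h1 h2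
  rw [abs_le] at *
  constructor <;> linarith

lemma stdUncond_truncatedCube {n : ℕ} (i₀ : Fin n) (a : ℝ) :
    StdUncond (truncatedCube i₀ a) := by
  intro x σ hσ
  have hs : ∀ i, |σ i| = 1 := fun i => by rcases hσ i with h | h <;> simp [h]
  rw [gauge_def', gauge_def']
  congr 1
  ext r
  have hn : ‖(EuclideanSpace.equiv (Fin n) ℝ).symm fun i => σ i * x i‖ =
      ‖(EuclideanSpace.equiv (Fin n) ℝ).symm x‖ := by
    simp [EuclideanSpace.norm_eq, hs]
  simp only [truncatedCube, Set.mem_ofPred_eq, norm_smul, hn, PiLp.smul_apply, smul_eq_mul, abs_mul]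
  simp [abs_mul, hs]

/-- The parallelogram identity of the ellipsoid norm, applied to the body `truncatedCube`. -/
lemma IsEuclideanSection.parallelogram_le {n : ℕ} {i₀ : Fin n} {a ε : ℝ} (ha : 0 < a)
    (hε : 0 < ε) {E : Submodule ℝ (Euc n)} (h : IsEuclideanSection (truncatedCube i₀ a) E ε)
    {p q : Euc n} (hp : p ∈ E) (hq : q ∈ E)
    (hpi : ∀ i, |p i| ≤ a * ‖p‖ + |p i₀| / 2) (hqi : ∀ i, |q i| ≤ a * ‖q‖ + |q i₀| / 2) :
    (a * ‖p + q‖ + |p i₀ + q i₀| / 2) ^ 2 + (a * ‖p - q‖ + |p i₀ - q i₀| / 2) ^ 2 ≤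
      2 * (1 + ε) ^ 2 * ((a * ‖p‖ + |p i₀| / 2) ^ 2 + (a * ‖q‖ + |q i₀| / 2) ^ 2) := by
  obtain ⟨T, h1, h2⟩ := h
  have lower : ∀ x : E, a * ‖(x : Euc n)‖ + |(x : Euc n) i₀| / 2 ≤ ‖T.symm x‖ := by
    intro x
    by_cases hy : T.symm x = 0
    · have : x = 0 := by simpa using hy
      simp [this]
    have hy0 : 0 < ‖T.symm x‖ := norm_pos_iff.2 hy
    have h3 := h1 ⟨‖T.symm x‖⁻¹ • T.symm x, by
      simp only [Set.mem_ofPred_eq, Submodule.coe_norm, Submodule.coe_smul]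
      rw [norm_smul, ← Submodule.coe_norm, norm_inv, norm_norm, inv_mul_cancel₀ hy0.ne'], rfl⟩
    have h4 := h3.2
    rw [map_smul, LinearEquiv.apply_symm_apply] at h4
    simp only [Submodule.coe_smul, norm_smul, PiLp.smul_apply, smul_eq_mul, abs_mul, norm_inv,
      norm_norm, abs_inv, abs_norm] at h4
    have h5 : ‖T.symm x‖⁻¹ * (a * ‖(x : Euc n)‖ + |(x : Euc n) i₀| / 2) ≤ 1 := by
      linarith
    rwa [inv_mul_le_iff₀ hy0, mul_one] at h5
  have upper : ∀ x : E, (∀ i, |(x : Euc n) i| ≤ a * ‖(x : Euc n)‖ + |(x : Euc n) i₀| / 2) →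
      ‖T.symm x‖ ≤ (1 + ε) * (a * ‖(x : Euc n)‖ + |(x : Euc n) i₀| / 2) := by
    intro x hx
    by_cases hx0 : x = 0
    · simp [hx0]
    have hr : 0 < a * ‖(x : Euc n)‖ + |(x : Euc n) i₀| / 2 := by
      have : 0 < ‖(x : Euc n)‖ := by simpa using hx0
      positivity
    set r := a * ‖(x : Euc n)‖ + |(x : Euc n) i₀| / 2 with hrdef
    have hmem : ((r⁻¹ • x : E) : Euc n) ∈ truncatedCube i₀ a := by
      refine ⟨fun i => ?_, ?_⟩
      · simp only [Submodule.coe_smul, PiLp.smul_apply, smul_eq_mul, abs_mul, abs_inv,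
          abs_of_pos hr]
        rw [inv_mul_le_iff₀ hr, mul_one]
        exact hx i
      · simp only [Submodule.coe_smul, PiLp.smul_apply, smul_eq_mul, abs_mul, abs_inv,
          abs_of_pos hr, norm_smul, norm_inv, Real.norm_of_nonneg hr.le]
        have : r⁻¹ * r = 1 := inv_mul_cancel₀ hr.ne'
        nlinarith
    obtain ⟨_, ⟨z, hz, rfl⟩, hzx⟩ := h2 hmem
    have h3 : T.symm x = (r * (1 + ε)) • z := by
      have h4 : x = r • ((1 + ε) • T z) := by
        simp only at hzx
        rw [hzx, smul_inv_smul₀ hr.ne']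
      rw [h4, map_smul, map_smul, LinearEquiv.symm_apply_apply, smul_smul]
    have hz' : ‖z‖ ≤ 1 := by simpa using hz
    rw [h3, norm_smul, Real.norm_of_nonneg (by positivity)]
    nlinarith [mul_pos hr (by linarith : 0 < 1 + ε)]
  have l1 := lower (⟨p, hp⟩ + ⟨q, hq⟩)
  have l2 := lower (⟨p, hp⟩ - ⟨q, hq⟩)
  have u1 := upper ⟨p, hp⟩ hpi
  have u2 := upper ⟨q, hq⟩ hqi
  have par := parallelogram_law_with_norm ℝ (T.symm ⟨p, hp⟩) (T.symm ⟨q, hq⟩)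
  rw [← map_add, ← map_sub] at par
  simp only [Submodule.coe_add, Submodule.coe_sub, PiLp.add_apply, PiLp.sub_apply] at l1 l2
  have l1' := pow_le_pow_left₀ (by positivity) l1 2
  have l2' := pow_le_pow_left₀ (by positivity) l2 2
  have u1' := pow_le_pow_left₀ (by positivity) u1 2
  have u2' := pow_le_pow_left₀ (by positivity) u2 2
  rw [mul_pow] at u1' u2'
  simp only at u1' u2'
  nlinarith

lemma no_almost_parallelogram {ε b U V W₁ W₂ τ s : ℝ} (hε : 0 < ε) (hε1 : ε ≤ 1)
    (hU1 : 0 ≤ U) (hU2 : U ≤ 0.6 * b) (hV1 : 0.9 * b ≤ V) (hV2 : V ≤ 1.1 * b)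
    (hW1 : 0 ≤ W₁) (hW2 : 0 ≤ W₂) (hW : W₁ ^ 2 + W₂ ^ 2 = 2 * (U ^ 2 + V ^ 2))
    (hWV : 2 * V ≤ W₁ + W₂) (hb : 0 < b) (hτ : 120 * ε * b ≤ τ) (hτb : τ ≤ b / 2)
    (hs : |s| ≤ τ / 10)
    (h : (W₁ + |τ + s| / 2) ^ 2 + (W₂ + |τ - s| / 2) ^ 2 ≤
      2 * (1 + ε) ^ 2 * ((U + τ / 2) ^ 2 + (V + |s| / 2) ^ 2)) : False := by
  have hτ0 : 0 < τ := lt_of_lt_of_le (by positivity) hτ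
  set σ := |s| with hσ
  have hσ0 : 0 ≤ σ := abs_nonneg s
  have hs1 := abs_le.1 (le_refl |s|)
  have e1 : |τ + s| = τ + s := abs_of_nonneg (by linarith [hs1.1])
  have e2 : |τ - s| = τ - s := abs_of_nonneg (by linarith [hs1.2])
  have e3 : s ^ 2 = σ ^ 2 := (sq_abs s).symm
  rw [e1, e2] at h
  have k1 : W₁ * (τ - σ) ≤ W₁ * (τ + s) := mul_le_mul_of_nonneg_left (by linarith [hs1.1]) hW1
  have k2 : W₂ * (τ - σ) ≤ W₂ * (τ - s) := mul_le_mul_of_nonneg_left (by linarith [hs1.2]) hW2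
  have k3 : 2 * V * (τ - σ) ≤ (W₁ + W₂) * (τ - σ) :=
    mul_le_mul_of_nonneg_right hWV (by linarith)
  have hV0 : 0 ≤ V := by linarith
  set R := (U + τ / 2) ^ 2 + (V + σ / 2) ^ 2 with hR
  have low : 2 * R + 2 * V * τ - 4 * V * σ - 2 * U * τ ≤
      (W₁ + (τ + s) / 2) ^ 2 + (W₂ + (τ - s) / 2) ^ 2 := by
    have : (W₁ + (τ + s) / 2) ^ 2 + (W₂ + (τ - s) / 2) ^ 2 =
        2 * (U ^ 2 + V ^ 2) + W₁ * (τ + s) + W₂ * (τ - s) + (τ ^ 2 + σ ^ 2) / 2 := by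
      rw [← hW, ← e3]; ring
    rw [this, hR]
    linarith
  have hRb : R ≤ 2.5 * b ^ 2 := by
    have a1 : (U + τ / 2) ^ 2 ≤ (0.85 * b) ^ 2 :=
      pow_le_pow_left₀ (by positivity) (by linarith) 2
    have a2 : (V + σ / 2) ^ 2 ≤ (1.125 * b) ^ 2 :=
      pow_le_pow_left₀ (by positivity) (by linarith) 2
    have : 0 < b ^ 2 := by positivity
    linarith
  have hR0 : 0 ≤ R := by positivity
  have gap : 0.16 * b * τ ≤ 2 * V * τ - 4 * V * σ - 2 * U * τ := by
    have b1 : V * σ ≤ V * (τ / 10) := mul_le_mul_of_nonneg_left hs hV0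
    have b2 : 0.9 * b * τ ≤ V * τ := mul_le_mul_of_nonneg_right hV1 hτ0.le
    have b3 : U * τ ≤ 0.6 * b * τ := mul_le_mul_of_nonneg_right hU2 hτ0.le
    have b4 : 0 < b * τ := by positivity
    linarith
  have c1 : 0.16 * b * τ ≤ 6 * ε * R := by
    have d1 : 0 ≤ ε * R * (1 - ε) := mul_nonneg (by positivity) (by linarith)
    linarith
  have c2 : ε * R ≤ ε * (2.5 * b ^ 2) := mul_le_mul_of_nonneg_left hRb hε.le
  have c3 : b * (120 * ε * b) ≤ b * τ := mul_le_mul_of_nonneg_left hτ hb.le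
  have : 0 < ε * b ^ 2 := by positivity
  linarith

lemma variance_sq_gaussianReal_le : Var[fun x : ℝ => x ^ 2; gaussianReal 0 1] ≤ 100 := by
  have hX : AEMeasurable (fun x : ℝ => x ^ 2) (gaussianReal 0 1) := by fun_prop
  refine (variance_le_expectation_sq hX.aestronglyMeasurable).trans ?_
  have hmgf : ∀ t : ℝ, ∫ x, Real.exp (t * x) ∂gaussianReal 0 1 = Real.exp (t ^ 2 / 2) := by
    intro t
    have := congrFun (mgf_id_gaussianReal (μ := 0) (v := 1)) t
    simpa [mgf] using this
  have hi : ∀ t : ℝ, Integrable (fun x => Real.exp (t * x)) (gaussianReal 0 1) :=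
    fun t => integrable_exp_mul_gaussianReal t
  have hle : ∀ x : ℝ, (x ^ 2) ^ 2 ≤ 24 * (Real.exp (1 * x) + Real.exp ((-1) * x)) := by
    intro x
    have h1 := Real.pow_div_factorial_le_exp |x| (abs_nonneg x) 4
    have h2 : |x| ^ 4 = (x ^ 2) ^ 2 := by rw [← sq_abs x]; ring
    have h3 : Real.exp |x| ≤ Real.exp (1 * x) + Real.exp ((-1) * x) := by
      rcases abs_cases x with ⟨h, _⟩ | ⟨h, _⟩ <;> rw [h]
      · have := Real.exp_pos (-1 * x); simp only [one_mul]; linarith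
      · have := Real.exp_pos (1 * x); simp only [neg_mul, one_mul]; linarith [Real.exp_pos x]
    rw [h2] at h1
    have h4 : ((Nat.factorial 4 : ℕ) : ℝ) = 24 := by norm_num [Nat.factorial]
    rw [h4] at h1
    linarith
  have h5 : ∫ x, ((fun x : ℝ => x ^ 2) ^ 2) x ∂gaussianReal 0 1 ≤
      ∫ x, 24 * (Real.exp (1 * x) + Real.exp ((-1) * x)) ∂gaussianReal 0 1 := by
    refine integral_mono_of_nonneg (ae_of_all _ fun x => sq_nonneg (x ^ 2))
      (((hi 1).add (hi (-1))).const_mul 24) (ae_of_all _ fun x => ?_)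
    simpa using hle x
  refine h5.trans ?_
  rw [integral_const_mul, integral_add (hi 1) (hi (-1)), hmgf, hmgf]
  have : Real.exp (1 / 2) ≤ 2 := by
    have h6 : Real.exp (1 / 2) * Real.exp (1 / 2) = Real.exp 1 := by
      rw [← Real.exp_add]; norm_num
    have := Real.exp_one_lt_d9
    nlinarith [Real.exp_pos (1 / 2)]
  norm_num at this ⊢
  linarith

lemma memLp_sq_gaussianReal : MemLp (fun x : ℝ => x ^ 2) 2 (gaussianReal 0 1) := by
  have h := memLp_id_gaussianReal' (μ := 0) (v := 1) 4 (by norm_num)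
  refine (memLp_two_iff_integrable_sq (by fun_prop)).2 ?_
  have := h.integrable_norm_pow (by norm_num)
  refine this.congr (ae_of_all _ fun x => ?_)
  simp only [id, Real.norm_eq_abs, Even.pow_abs (by decide : Even 4), ← pow_mul]

lemma integral_sq_gaussianReal : ∫ x, x ^ 2 ∂gaussianReal 0 1 = 1 := by
  have h := variance_id_gaussianReal (μ := 0) (v := 1)
  rw [variance_of_integral_eq_zero (by fun_prop) (by simp)] at h
  simpa using h

/-- Chebyshev's inequality for a sum of squares of independent standard Gaussians. -/
lemma measure_sum_sq_deviation_le {ι : Type*} [Fintype ι] (S : Finset ι) {δ : ℝ}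
    (hδ : 0 < δ) (hS : 0 < S.card) :
    (Measure.pi fun _ : ι => gaussianReal 0 1)
      {x | δ * S.card ≤ |∑ i ∈ S, x i ^ 2 - S.card|} ≤
      ENNReal.ofReal (100 / (δ ^ 2 * S.card)) := by
  classical
  have hS' : (0 : ℝ) < S.card := by exact_mod_cast hS
  let f : ι → ℝ → ℝ := fun i x => if i ∈ S then x ^ 2 else 0
  have hf : ∀ i, MemLp (f i) 2 (gaussianReal 0 1) := by
    intro i
    by_cases h : i ∈ S
    · simpa [f, h] using memLp_sq_gaussianReal
    · simp [f, h]
  let F : (ι → ℝ) → ℝ := ∑ i, fun ω => f i (ω i)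
  have hF : ∀ x, F x = ∑ i ∈ S, x i ^ 2 := by
    intro x
    simp [F, f, Finset.sum_apply, Finset.sum_ite_mem]
  have hfpi : ∀ i, MemLp (fun ω : ι → ℝ => f i (ω i)) 2
      (Measure.pi fun _ : ι => gaussianReal 0 1) := fun i =>
    (hf i).comp_measurePreserving (measurePreserving_eval (fun _ : ι => gaussianReal 0 1) i)
  have hFm : MemLp F 2 (Measure.pi fun _ : ι => gaussianReal 0 1) :=
    memLp_finsetSum' _ fun i _ => hfpi i
  have hmean : ∫ x, F x ∂(Measure.pi fun _ : ι => gaussianReal 0 1) = S.card := by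
    have : ∀ i ∈ S, ∫ x : ι → ℝ, x i ^ 2 ∂(Measure.pi fun _ : ι => gaussianReal 0 1) = 1 := by
      intro i _
      have h := integral_map (μ := Measure.pi fun _ : ι => gaussianReal 0 1)
        (φ := Function.eval i) (measurable_pi_apply i).aemeasurable
        (f := fun x : ℝ => x ^ 2) (by fun_prop)
      rw [(measurePreserving_eval (fun _ : ι => gaussianReal 0 1) i).map_eq,
        integral_sq_gaussianReal] at h
      exact h.symm
    simp_rw [hF]
    rw [integral_finsetSum, Finset.sum_congr rfl this]
    · simp
    · intro i hi
      have := (hfpi i).integrable (by norm_num)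
      simpa [f, hi] using this
  have hvar : Var[F; Measure.pi fun _ : ι => gaussianReal 0 1] ≤ 100 * S.card := by
    simp only [F]
    rw [variance_sum_pi hf]
    have : ∀ i, Var[f i; gaussianReal 0 1] ≤ if i ∈ S then 100 else 0 := by
      intro i
      by_cases h : i ∈ S
      · simpa [f, h] using variance_sq_gaussianReal_le
      · have : f i = 0 := by ext; simp [f, h]
        simp [this, h]
    refine (Finset.sum_le_sum fun i _ => this i).trans ?_
    simp [Finset.sum_ite_mem, mul_comm]
  have key := meas_ge_le_variance_div_sq hFm (c := δ * S.card) (by positivity)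
  rw [hmean] at key
  simp_rw [hF] at key
  refine key.trans (ENNReal.ofReal_le_ofReal ?_)
  rw [div_le_div_iff₀ (by positivity) (by positivity)]
  have : 0 ≤ δ ^ 2 * S.card := by positivity
  nlinarith

lemma measure_lt_abs_gaussianReal_le {r : ℝ} (hr : 0 ≤ r) :
    gaussianReal 0 1 {x | r < |x|} ≤ ENNReal.ofReal (2 * Real.exp (-r ^ 2 / 2)) := by
  have hm : ∀ t, mgf id (gaussianReal 0 1) t = Real.exp (t ^ 2 / 2) := by
    intro t; rw [mgf_id_gaussianReal]; simp
  have h1 := measure_ge_le_exp_mul_mgf (X := id) (μ := gaussianReal 0 1) r hr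
    (integrable_exp_mul_gaussianReal r)
  have h2 := measure_le_le_exp_mul_mgf (X := id) (μ := gaussianReal 0 1) (-r) (neg_nonpos.2 hr)
    (integrable_exp_mul_gaussianReal (-r))
  rw [hm, ← Real.exp_add] at h1 h2
  have h3 : {x : ℝ | r < |x|} ⊆ {x | r ≤ id x} ∪ {x | id x ≤ -r} := by
    intro x hx
    have hx' : r < |x| := hx
    rcases lt_abs.1 hx' with h | h
    · exact Or.inl h.le
    · exact Or.inr (by simp only [id, Set.mem_ofPred_eq]; linarith)
  have h4 : (gaussianReal 0 1).real {x | r < |x|} ≤ 2 * Real.exp (-r ^ 2 / 2) := by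
    refine (measureReal_mono h3).trans ((measureReal_union_le _ _).trans ?_)
    have e1 : -r * r + r ^ 2 / 2 = -r ^ 2 / 2 := by ring
    have e2 : - -r * -r + (-r) ^ 2 / 2 = -r ^ 2 / 2 := by ring
    rw [e1] at h1
    rw [e2] at h2
    linarith
  rw [← ofReal_measureReal]
  exact ENNReal.ofReal_le_ofReal h4

/-- A unit-norm linear combination of independent standard Gaussians is standard Gaussian. -/
lemma map_sum_mul_pi_gaussianReal {κ : Type*} [Fintype κ] (w : κ → ℝ) (hw : ∑ j, w j ^ 2 = 1) :
    (Measure.pi fun _ : κ => gaussianReal 0 1).map (fun x => ∑ j, x j * w j) =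
      gaussianReal 0 1 := by
  have hmeas : Measurable fun x : κ → ℝ => ∑ j, x j * w j := by fun_prop
  have : IsProbabilityMeasure ((Measure.pi fun _ : κ => gaussianReal 0 1).map
      (fun x => ∑ j, x j * w j)) := Measure.isProbabilityMeasure_map hmeas.aemeasurable
  apply Measure.ext_of_charFun
  ext t
  rw [charFun_apply_real, integral_map hmeas.aemeasurable (by fun_prop)]
  have h1 : ∀ x : κ → ℝ, Complex.exp (t * (∑ j, x j * w j : ℝ) * Complex.I) =
      ∏ j, Complex.exp ((t * w j : ℝ) * x j * Complex.I) := by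
    intro x
    rw [← Complex.exp_sum]
    congr 1
    push_cast
    rw [Finset.mul_sum, Finset.sum_mul]
    exact Finset.sum_congr rfl fun j _ => by ring
  simp_rw [h1]
  rw [integral_fintype_prod_eq_prod
    (f := fun j (x : ℝ) => Complex.exp ((t * w j : ℝ) * x * Complex.I))]
  simp_rw [← charFun_apply_real, charFun_gaussianReal]
  rw [← Complex.exp_sum]
  congr 1
  have h2 : ((∑ j, w j ^ 2 : ℝ) : ℂ) = 1 := by rw [hw]; simp
  push_cast at h2
  simp only [Complex.ofReal_zero, mul_zero, zero_mul, NNReal.coe_one, Complex.ofReal_one, one_mul,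
    zero_sub, Complex.ofReal_mul, mul_pow]
  rw [Finset.sum_neg_distrib, ← Finset.sum_div, ← Finset.mul_sum, h2, mul_one]

/-- The rows `R i` fail to be typical in the direction `w`: either the sum of squares of their
products with `w` is far from its mean, or one of these products is large. -/
def atypicalRows (m k : ℕ) (r : ℝ) (w : Fin k → ℝ) : Set (Fin m → Fin k → ℝ) :=
  {R | 0.1 * m * ∑ j, w j ^ 2 < |∑ i, (∑ j, R i j * w j) ^ 2 - m * ∑ j, w j ^ 2| ∨
    ∃ i, r * √(∑ j, w j ^ 2) < |∑ j, R i j * w j|}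

lemma measure_atypicalRows_le {m k : ℕ} (hm : 0 < m) {r : ℝ} (hr : 0 ≤ r) (w : Fin k → ℝ) :
    (Measure.pi fun _ : Fin m => Measure.pi fun _ : Fin k => gaussianReal 0 1)
      (atypicalRows m k r w) ≤
      ENNReal.ofReal (10000 / m) + m * ENNReal.ofReal (2 * Real.exp (-r ^ 2 / 2)) := by
  by_cases hw : ∑ j, w j ^ 2 = 0
  · have hw0 : ∀ j, w j = 0 := by
      intro j
      have := (Finset.sum_eq_zero_iff_of_nonneg (fun j _ => sq_nonneg (w j))).1 hw j
        (Finset.mem_univ j)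
      simpa using this
    simp [atypicalRows, hw0]
  set s := √(∑ j, w j ^ 2) with hs
  have hs2 : s ^ 2 = ∑ j, w j ^ 2 := Real.sq_sqrt (Finset.sum_nonneg fun j _ => sq_nonneg _)
  have hs0 : 0 < s := Real.sqrt_pos.2
    (lt_of_le_of_ne (Finset.sum_nonneg fun j _ => sq_nonneg _) (Ne.symm hw))
  let v : Fin k → ℝ := fun j => w j / s
  have hv : ∑ j, v j ^ 2 = 1 := by
    simp only [v, div_pow]
    rw [← Finset.sum_div, ← hs2, div_self (by positivity)]
  let Φ : (Fin m → Fin k → ℝ) → Fin m → ℝ := fun R i => ∑ j, R i j * v j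
  have hΦm : Measurable Φ := by fun_prop
  have hΦ : (Measure.pi fun _ : Fin m => Measure.pi fun _ : Fin k => gaussianReal 0 1).map Φ =
      Measure.pi fun _ : Fin m => gaussianReal 0 1 := by
    have hl := map_sum_mul_pi_gaussianReal v hv
    have : SigmaFinite ((Measure.pi fun _ : Fin k => gaussianReal 0 1).map
      (fun x => ∑ j, x j * v j)) := by rw [hl]; infer_instance
    have := Measure.pi_map_pi (μ := fun _ : Fin m => Measure.pi fun _ : Fin k => gaussianReal 0 1)
      (f := fun _ x => ∑ j, x j * v j) (fun _ => Measurable.aemeasurable (by fun_prop))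
    rw [hl] at this
    exact this
  have hm' : (0 : ℝ) < m := by exact_mod_cast hm
  let A : Set (Fin m → ℝ) := {x | 0.1 * (Finset.univ : Finset (Fin m)).card ≤
    |∑ i, x i ^ 2 - (Finset.univ : Finset (Fin m)).card|}
  let D : Fin m → Set (Fin m → ℝ) := fun i => Function.eval i ⁻¹' {x | r < |x|}
  have hDm : ∀ i, MeasurableSet (D i) := fun i =>
    (measurable_pi_apply i) (measurableSet_lt measurable_const (by fun_prop))
  have hAm : MeasurableSet A := measurableSet_le measurable_const (by fun_prop)
  have hsub : atypicalRows m k r w ⊆ Φ ⁻¹' (A ∪ ⋃ i, D i) := by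
    intro R hR
    have e : ∀ i, ∑ j, R i j * w j = s * Φ R i := by
      intro i
      simp only [Φ, v, Finset.mul_sum]
      exact Finset.sum_congr rfl fun j _ => by field_simp
    rcases hR with h | ⟨i, h⟩
    · left
      simp only [e, mul_pow, ← Finset.mul_sum, ← hs2] at h
      have h3 : s ^ 2 * ∑ i, Φ R i ^ 2 - m * s ^ 2 = s ^ 2 * (∑ i, Φ R i ^ 2 - m) := by ring
      rw [h3, abs_mul, abs_of_pos (by positivity)] at h
      simp only [A, Set.mem_ofPred_eq, Finset.card_univ, Fintype.card_fin]
      have h4 : s ^ 2 * (0.1 * m) < s ^ 2 * |∑ i, Φ R i ^ 2 - m| := by linarith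
      exact (lt_of_mul_lt_mul_left h4 (by positivity)).le
    · right
      refine Set.mem_iUnion.2 ⟨i, ?_⟩
      rw [e, abs_mul, abs_of_pos hs0, ← hs] at h
      have h4 : s * r < s * |Φ R i| := by linarith
      exact lt_of_mul_lt_mul_left h4 hs0.le
  refine (measure_mono hsub).trans ?_
  rw [← Measure.map_apply hΦm (hAm.union (MeasurableSet.iUnion hDm)), hΦ]
  refine (measure_union_le _ _).trans (add_le_add ?_ ?_)
  · refine (measure_sum_sq_deviation_le _ (by norm_num) (by simpa using hm)).trans
      (ENNReal.ofReal_le_ofReal ?_)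
    simp only [Finset.card_univ, Fintype.card_fin]
    rw [div_le_div_iff₀ (by positivity) hm']
    norm_num
    linarith
  · refine (measure_iUnion_le _).trans ?_
    rw [tsum_fintype]
    refine (Finset.sum_le_card_nsmul _ _ (ENNReal.ofReal (2 * Real.exp (-r ^ 2 / 2)))
      fun i _ => ?_).trans (by simp)
    rw [(measurePreserving_eval (fun _ : Fin m => gaussianReal 0 1) i).measure_preimage
      (measurableSet_lt measurable_const (by fun_prop)).nullMeasurableSet]
    exact measure_lt_abs_gaussianReal_le hr

lemma map_uncurry_pi_pi {ι κ : Type*} [Fintype ι] [Fintype κ] (μ : Measure ℝ)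
    [IsProbabilityMeasure μ] :
    (Measure.pi fun _ : ι => Measure.pi fun _ : κ => μ).map
      (fun R (p : ι × κ) => R p.1 p.2) = Measure.pi fun _ => μ := by
  refine (Measure.pi_eq fun s hs => ?_).symm
  rw [Measure.map_apply (by fun_prop) (MeasurableSet.univ_pi hs)]
  have : (fun (R : ι → κ → ℝ) (p : ι × κ) => R p.1 p.2) ⁻¹' Set.univ.pi s =
      Set.univ.pi fun i => Set.univ.pi fun j => s (i, j) := by
    ext R; simp [Set.mem_pi]
  rw [this, Measure.pi_pi]
  simp_rw [Measure.pi_pi]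
  rw [Fintype.prod_prod_type]

lemma map_uncurry_swap_pi_pi {ι κ : Type*} [Fintype ι] [Fintype κ] (μ : Measure ℝ)
    [IsProbabilityMeasure μ] :
    (Measure.pi fun _ : ι => Measure.pi fun _ : κ => μ).map
      (fun R (p : κ × ι) => R p.2 p.1) = Measure.pi fun _ => μ := by
  refine (Measure.pi_eq fun s hs => ?_).symm
  rw [Measure.map_apply (by fun_prop) (MeasurableSet.univ_pi hs)]
  have : (fun (R : ι → κ → ℝ) (p : κ × ι) => R p.2 p.1) ⁻¹' Set.univ.pi s =
      Set.univ.pi fun i => Set.univ.pi fun j => s (j, i) := by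
    ext R; simp only [Set.mem_preimage, Set.mem_pi, Set.mem_univ, true_implies, Prod.forall]
    exact forall_comm
  rw [this, Measure.pi_pi]
  simp_rw [Measure.pi_pi]
  rw [Fintype.prod_prod_type_right]

lemma measurePreserving_flip {ι κ : Type*} [Fintype ι] [Fintype κ] (μ : Measure ℝ)
    [IsProbabilityMeasure μ] :
    MeasurePreserving (fun (R : ι → κ → ℝ) j i => R i j)
      (Measure.pi fun _ => Measure.pi fun _ => μ) (Measure.pi fun _ => Measure.pi fun _ => μ) := by
  refine ⟨by fun_prop, ?_⟩
  have h1 := map_uncurry_swap_pi_pi (ι := ι) (κ := κ) μ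
  rw [← map_uncurry_pi_pi (ι := κ) (κ := ι) μ] at h1
  have h2 := congrArg (Measure.map fun (x : κ × ι → ℝ) j i => x (j, i)) h1
  rw [Measure.map_map (by fun_prop) (by fun_prop), Measure.map_map (by fun_prop) (by fun_prop)]
    at h2
  exact h2.trans Measure.map_id

/-- The first coordinates and the remaining ones of `k` independent standard Gaussian vectors. -/
def splitRows (m k : ℕ) (X : Fin k → Euc (m + 1)) : (Fin k → ℝ) × (Fin m → Fin k → ℝ) :=
  (fun j => X j 0, fun i j => X j i.succ)

lemma measurePreserving_splitRows (m k : ℕ) :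
    MeasurePreserving (splitRows m k) (Measure.pi fun _ : Fin k => stdGaussian (m + 1))
      ((Measure.pi fun _ : Fin k => gaussianReal 0 1).prod
        (Measure.pi fun _ : Fin m => Measure.pi fun _ : Fin k => gaussianReal 0 1)) := by
  have h0 : (stdGaussian (m + 1)).map (fun x i => x i) =
      Measure.pi fun _ : Fin (m + 1) => gaussianReal 0 1 := by
    rw [_root_.stdGaussian, Measure.map_map (by fun_prop) (by fun_prop)]
    exact Measure.map_id
  have : SigmaFinite ((stdGaussian (m + 1)).map (fun x i => x i)) := by rw [h0]; infer_instance
  have h1 : MeasurePreserving (fun (X : Fin k → Euc (m + 1)) j i => X j i)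
      (Measure.pi fun _ : Fin k => stdGaussian (m + 1))
      (Measure.pi fun _ : Fin k => Measure.pi fun _ : Fin (m + 1) => gaussianReal 0 1) := by
    refine ⟨by fun_prop, ?_⟩
    have := Measure.pi_map_pi (μ := fun _ : Fin k => stdGaussian (m + 1))
      (f := fun _ x i => x i) (fun _ => by fun_prop)
    rw [h0] at this
    exact this
  have h2 := measurePreserving_flip (ι := Fin k) (κ := Fin (m + 1)) (gaussianReal 0 1)
  have h3 := measurePreserving_piFinSuccAbove
    (fun _ : Fin (m + 1) => Measure.pi fun _ : Fin k => gaussianReal 0 1) 0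
  exact h3.comp (h2.comp h1)

lemma prod_apply_le_of_forall_section_le {α β : Type*} [MeasurableSpace α] [MeasurableSpace β]
    (μ : Measure α) (ν : Measure β) [IsProbabilityMeasure μ] [SFinite ν] {s : Set (α × β)}
    (hs : MeasurableSet s) {c : ℝ≥0∞} (h : ∀ x, ν (Prod.mk x ⁻¹' s) ≤ c) : μ.prod ν s ≤ c := by
  rw [Measure.prod_apply hs]
  exact (lintegral_mono h).trans (by simp)

lemma measurableSet_mem_atypicalRows (m k : ℕ) (r : ℝ) :
    MeasurableSet {P : (Fin k → ℝ) × (Fin m → Fin k → ℝ) | P.2 ∈ atypicalRows m k r P.1} := by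
  have h1 : MeasurableSet {P : (Fin k → ℝ) × (Fin m → Fin k → ℝ) | 0.1 * m * ∑ j, P.1 j ^ 2 <
      |∑ i, (∑ j, P.2 i j * P.1 j) ^ 2 - m * ∑ j, P.1 j ^ 2|} :=
    measurableSet_lt (by fun_prop) (by fun_prop)
  have h2 : ∀ i, MeasurableSet {P : (Fin k → ℝ) × (Fin m → Fin k → ℝ) |
      r * √(∑ j, P.1 j ^ 2) < |∑ j, P.2 i j * P.1 j|} := fun i =>
    measurableSet_lt (by fun_prop) (by fun_prop)
  refine (h1.union (MeasurableSet.iUnion h2)).congr ?_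
  ext P
  simp [atypicalRows]

/-- The vector `g` restricted to the coordinates in `S`. -/
def restrictTo {k : ℕ} (S : Finset (Fin k)) (g : Fin k → ℝ) (j : Fin k) : ℝ :=
  if j ∈ S then g j else 0

lemma measurable_restrictTo {k : ℕ} (S : Finset (Fin k)) : Measurable (restrictTo S) := by
  refine measurable_pi_iff.2 fun j => ?_
  by_cases h : j ∈ S
  · simpa [restrictTo, h] using measurable_pi_apply j
  · simp [restrictTo, h]

lemma sum_restrictTo_sq {k : ℕ} (S : Finset (Fin k)) (g : Fin k → ℝ) :
    ∑ j, restrictTo S g j ^ 2 = ∑ j ∈ S, g j ^ 2 := by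
  simp [restrictTo, ite_pow, Finset.sum_ite_mem]

lemma sum_mul_restrictTo {k : ℕ} (S : Finset (Fin k)) (g : Fin k → ℝ) :
    ∑ j, g j * restrictTo S g j = ∑ j ∈ S, g j ^ 2 := by
  simp [restrictTo, Finset.sum_ite_mem, sq]

set_option maxHeartbeats 1000000 in
lemma not_isEuclideanSection_of_typical {m k : ℕ} {L ε : ℝ} (X : Fin k → Euc (m + 1))
    (S : Finset (Fin k)) (j₀ : Fin k) (hε : 0 < ε) (hε1 : ε ≤ 1) (hm : 100000 ≤ (m : ℝ))
    (hL : 0 < L) (hLm : 100 * L ≤ m) (hS1 : 40000 ≤ ∑ j ∈ S, X j 0 ^ 2)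
    (hS2 : ∑ j ∈ S, X j 0 ^ 2 ≤ 16 * L) (hS3 : 921600 * (ε ^ 2 * L) ≤ ∑ j ∈ S, X j 0 ^ 2)
    (hs : |X j₀ 0| ≤ 10)
    (hp : (splitRows m k X).2 ∉ atypicalRows m k (2 * √L) (restrictTo S (splitRows m k X).1))
    (hq : (splitRows m k X).2 ∉ atypicalRows m k (2 * √L) (Pi.single j₀ 1)) :
    ¬ IsEuclideanSection (truncatedCube 0 (4 * √L / √(m + 1)))
      (Submodule.span ℝ (Set.range X)) ε := by
  intro hE
  set N : ℝ := √(m + 1) with hN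
  have hN0 : 0 < N := by positivity
  have hN2 : N ^ 2 = m + 1 := Real.sq_sqrt (by positivity)
  set l := √L with hl
  have hl0 : 0 < l := Real.sqrt_pos.2 hL
  have hl2 : l ^ 2 = L := Real.sq_sqrt hL.le
  set Q := ∑ j ∈ S, X j 0 ^ 2 with hQ
  set t := √Q with ht
  have ht2 : t ^ 2 = Q := Real.sq_sqrt (by linarith)
  have ht0 : 0 < t := Real.sqrt_pos.2 (by linarith)
  set w := restrictTo S (splitRows m k X).1 with hw
  have hw2 : ∑ j, w j ^ 2 = t ^ 2 := by rw [hw, sum_restrictTo_sq, ht2]; rfl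
  simp only [atypicalRows, Set.mem_ofPred_eq, not_or, not_lt, not_exists] at hp hq
  rw [hw2, Real.sqrt_sq ht0.le] at hp
  have hsingle : ∑ j, (Pi.single j₀ 1 : Fin k → ℝ) j ^ 2 = 1 := by
    simp [Pi.single_apply, ite_pow]
  have hsingle' : ∀ i, ∑ j, (splitRows m k X).2 i j * (Pi.single j₀ 1 : Fin k → ℝ) j =
      X j₀ i.succ := by
    intro i; simp [Pi.single_apply, splitRows]
  rw [hsingle] at hq
  simp only [hsingle', Real.sqrt_one, mul_one] at hq
  obtain ⟨hp1, hp2⟩ := hp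
  obtain ⟨hq1, hq2⟩ := hq
  set q := X j₀ with hqdef
  set p : Euc (m + 1) := ∑ j, (w j / (2 * t)) • X j with hpdef
  have hpE : p ∈ Submodule.span ℝ (Set.range X) :=
    Submodule.sum_mem _ fun j _ => Submodule.smul_mem _ _ (Submodule.subset_span ⟨j, rfl⟩)
  have hqE : q ∈ Submodule.span ℝ (Set.range X) := Submodule.subset_span ⟨j₀, rfl⟩
  have hpi : ∀ i, p i = (∑ j, X j i * w j) / (2 * t) := by
    intro i
    simp only [hpdef, WithLp.ofLp_sum, Finset.sum_apply, PiLp.smul_apply, smul_eq_mul]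
    rw [Finset.sum_div]
    exact Finset.sum_congr rfl fun j _ => by ring
  have hp0 : p 0 = t / 2 := by
    rw [hpi]
    have : ∑ j, X j 0 * w j = t ^ 2 := by
      rw [ht2]; exact sum_mul_restrictTo S (fun j => X j 0)
    rw [this]; field_simp
  have hps : ∀ i : Fin m, p i.succ = (∑ j, (splitRows m k X).2 i j * w j) / (2 * t) :=
    fun i => hpi _
  have hpn : ‖p‖ ^ 2 = (t / 2) ^ 2 + ∑ i : Fin m, p i.succ ^ 2 := by
    rw [EuclideanSpace.real_norm_sq_eq, Fin.sum_univ_succ, hp0]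
  have hqn : ‖q‖ ^ 2 = q 0 ^ 2 + ∑ i : Fin m, q i.succ ^ 2 := by
    rw [EuclideanSpace.real_norm_sq_eq, Fin.sum_univ_succ]
  have hpsum : ∑ i : Fin m, p i.succ ^ 2 =
      (∑ i, (∑ j, (splitRows m k X).2 i j * w j) ^ 2) / (4 * t ^ 2) := by
    simp_rw [hps, div_pow]
    rw [← Finset.sum_div]; ring
  have hp1' := abs_le.1 hp1
  have hq1' := abs_le.1 hq1
  have hpl : 0.225 * m ≤ ∑ i : Fin m, p i.succ ^ 2 := by
    rw [hpsum, le_div_iff₀ (by positivity)]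
    linarith [hp1'.1]
  have hpu : ∑ i : Fin m, p i.succ ^ 2 ≤ 0.275 * m := by
    rw [hpsum, div_le_iff₀ (by positivity)]
    linarith [hp1'.2]
  have hτ2 : (t / 2) ^ 2 ≤ 4 * L := by rw [div_pow, ht2]; linarith
  have hpN1 : 0.4 * N ≤ ‖p‖ := by
    refine le_of_sq_le_sq ?_ (norm_nonneg _)
    rw [mul_pow, hN2, hpn]
    linarith [sq_nonneg (t / 2)]
  have hpN2 : ‖p‖ ≤ 0.6 * N := by
    refine le_of_sq_le_sq ?_ (by positivity)
    rw [mul_pow, hN2, hpn]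
    linarith
  have hqs2 : q 0 ^ 2 ≤ 100 := by
    rw [← sq_abs]
    nlinarith [abs_nonneg (q 0)]
  have hqN1 : 0.9 * N ≤ ‖q‖ := by
    refine le_of_sq_le_sq ?_ (norm_nonneg _)
    rw [mul_pow, hN2, hqn]
    linarith [hq1'.1, sq_nonneg (q 0)]
  have hqN2 : ‖q‖ ≤ 1.1 * N := by
    refine le_of_sq_le_sq ?_ (by positivity)
    rw [mul_pow, hN2, hqn]
    linarith [hq1'.2]
  set a := 4 * l / N with ha
  have ha0 : 0 < a := by positivity
  have haN : a * N = 4 * l := by rw [ha]; field_simp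
  have aP1 : 0.4 * (4 * l) ≤ a * ‖p‖ := by
    have := mul_le_mul_of_nonneg_left hpN1 ha0.le; linarith
  have aP2 : a * ‖p‖ ≤ 0.6 * (4 * l) := by
    have := mul_le_mul_of_nonneg_left hpN2 ha0.le; linarith
  have aQ1 : 0.9 * (4 * l) ≤ a * ‖q‖ := by
    have := mul_le_mul_of_nonneg_left hqN1 ha0.le; linarith
  have aQ2 : a * ‖q‖ ≤ 1.1 * (4 * l) := by
    have := mul_le_mul_of_nonneg_left hqN2 ha0.le; linarith
  have ht4 : t / 2 ≤ 4 * l / 2 := by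
    refine le_of_sq_le_sq ?_ (by positivity)
    calc (t / 2) ^ 2 ≤ 4 * L := hτ2
      _ = (4 * l / 2) ^ 2 := by rw [← hl2]; ring
  have hτε : 120 * ε * (4 * l) ≤ t / 2 := by
    refine le_of_sq_le_sq ?_ (by positivity)
    calc (120 * ε * (4 * l)) ^ 2 = 921600 * (ε ^ 2 * L) / 4 := by rw [← hl2]; ring
      _ ≤ Q / 4 := by linarith
      _ = (t / 2) ^ 2 := by rw [← ht2]; ring
  have hsτ : |q 0| ≤ t / 2 / 10 := by
    have : (100 : ℝ) ≤ t / 2 := by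
      refine le_of_sq_le_sq ?_ (by positivity)
      rw [div_pow, ht2]; linarith
    linarith
  have hp0a : |p 0| = t / 2 := by rw [hp0, abs_of_pos (by positivity)]
  have key := hE.parallelogram_le ha0 hε hpE hqE ?_ ?_
  · rw [hp0a, hp0] at key
    have par := parallelogram_law_with_norm ℝ p q
    refine no_almost_parallelogram (b := 4 * l) (U := a * ‖p‖) (V := a * ‖q‖)
      (W₁ := a * ‖p + q‖) (W₂ := a * ‖p - q‖) hε hε1 (by positivity) aP2 aQ1 aQ2
      (by positivity) (by positivity) ?_ ?_ (by positivity) hτε ht4 hsτ key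
    · linear_combination a ^ 2 * par
    · have h1 := norm_sub_le (p + q) (p - q)
      have h2 : p + q - (p - q) = (2 : ℝ) • q := by rw [two_smul]; abel
      rw [h2, norm_smul, Real.norm_of_nonneg (by norm_num)] at h1
      have := mul_le_mul_of_nonneg_left h1 ha0.le
      linarith
  · refine Fin.cases ?_ fun i => ?_
    · rw [hp0a]; linarith
    · have h1 : |p i.succ| ≤ l := by
        rw [hps, abs_div, abs_of_pos (show 0 < 2 * t by positivity), div_le_iff₀ (by positivity)]
        linarith [hp2 i]
      rw [hp0a]; linarith
  · have h0 := abs_nonneg (q 0)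
    refine Fin.cases ?_ fun i => ?_
    · linarith
    · linarith [hq2 i]

lemma measure_atypicalRows_le_eighth {m k : ℕ} {L : ℝ} (hL : 0 < L) (hexp : Real.exp L = m + 1)
    (hm : 100000 ≤ (m : ℝ)) (w : Fin k → ℝ) :
    (Measure.pi fun _ : Fin m => Measure.pi fun _ : Fin k => gaussianReal 0 1)
      (atypicalRows m k (2 * √L) w) ≤ ENNReal.ofReal (1 / 8) := by
  refine (measure_atypicalRows_le (by exact_mod_cast (by linarith : (0 : ℝ) < m))
    (by positivity) w).trans ?_
  rw [← ENNReal.ofReal_natCast m, ← ENNReal.ofReal_mul (by positivity),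
    ← ENNReal.ofReal_add (by positivity) (by positivity)]
  refine ENNReal.ofReal_le_ofReal ?_
  have h1 : -(2 * √L) ^ 2 / 2 = -(L + L) := by
    rw [mul_pow, Real.sq_sqrt (by linarith)]; ring
  rw [h1, Real.exp_neg, Real.exp_add, hexp]
  have h2 : 10000 / (m : ℝ) ≤ 1 / 10 := by
    rw [div_le_div_iff₀ (by linarith) (by norm_num)]; linarith
  have h3 : (m : ℝ) * (2 * (((m : ℝ) + 1) * (m + 1))⁻¹) ≤ 1 / 50 := by
    rw [← mul_assoc, ← div_eq_mul_inv, div_le_div_iff₀ (by positivity) (by norm_num)]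
    nlinarith
  linarith

/-- For `k` at least of order `ε² log n`, a random `k`-dimensional section of the truncated cube
is `(1+ε)`-Euclidean with probability at most `1/2`. -/
lemma measure_isEuclideanSection_truncatedCube_le {m k k₀ : ℕ} {L ε : ℝ} (hk₀k : k₀ ≤ k)
    (hL : 0 < L) (hexp : Real.exp L = m + 1) (hm0 : 100000 ≤ (m : ℝ)) (hLm : 100 * L ≤ m)
    (hε : 0 < ε) (hε1 : ε ≤ 1) (hk₀1 : 80000 ≤ (k₀ : ℝ)) (hk₀u : 3 / 2 * (k₀ : ℝ) ≤ 16 * L)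
    (hk₀l : 1843200 * (ε ^ 2 * L) ≤ k₀) :
    (Measure.pi fun _ : Fin k => stdGaussian (m + 1))
      {X : Fin k → Euc (m + 1) |
        Module.finrank ℝ (Submodule.span ℝ (Set.range X)) = k ∧
        IsEuclideanSection (truncatedCube 0 (4 * √L / √(m + 1)))
          (Submodule.span ℝ (Set.range X)) ε} ≤ 1/2 := by
  let S : Finset (Fin k) := Finset.univ.map (Fin.castLEEmb hk₀k)
  have hS : S.card = k₀ := by simp [S]
  let j₀ : Fin k := ⟨0, lt_of_lt_of_le (by exact_mod_cast (by linarith : (0 : ℝ) < k₀)) hk₀k⟩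
  let μ := Measure.pi fun _ : Fin k => gaussianReal 0 1
  let ν := Measure.pi fun _ : Fin m => Measure.pi fun _ : Fin k => gaussianReal 0 1
  let B₁ : Set (Fin k → ℝ) := {g | 1 / 2 * S.card ≤ |∑ j ∈ S, g j ^ 2 - S.card|}
  let B₂ : Set (Fin k → ℝ) := Function.eval j₀ ⁻¹' {x | 10 < |x|}
  let B₃ : Set ((Fin k → ℝ) × (Fin m → Fin k → ℝ)) :=
    {P | P.2 ∈ atypicalRows m k (2 * √L) (restrictTo S P.1)}
  let B₄ : Set ((Fin k → ℝ) × (Fin m → Fin k → ℝ)) :=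
    {P | P.2 ∈ atypicalRows m k (2 * √L) (Pi.single j₀ 1)}
  have hB₁ : MeasurableSet B₁ := measurableSet_le measurable_const (by fun_prop)
  have hB₂' : MeasurableSet {x : ℝ | 10 < |x|} := measurableSet_lt measurable_const (by fun_prop)
  have hB₂ : MeasurableSet B₂ := measurable_pi_apply j₀ hB₂'
  have hB₃ : MeasurableSet B₃ :=
    (((measurable_restrictTo S).comp measurable_fst).prodMk measurable_snd)
      (measurableSet_mem_atypicalRows m k _)
  have hB₄ : MeasurableSet B₄ :=
    ((measurable_const (a := (Pi.single j₀ 1 : Fin k → ℝ))).prodMk measurable_snd)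
      (measurableSet_mem_atypicalRows m k _)
  have m₁ : μ B₁ ≤ ENNReal.ofReal (1 / 8) := by
    refine (measure_sum_sq_deviation_le S (by norm_num) ?_).trans (ENNReal.ofReal_le_ofReal ?_)
    · rw [hS]; exact_mod_cast (by linarith : (0 : ℝ) < k₀)
    · rw [hS, div_le_div_iff₀ (by positivity) (by norm_num)]
      linarith
  have m₂ : μ B₂ ≤ ENNReal.ofReal (1 / 8) := by
    rw [(measurePreserving_eval (fun _ : Fin k => gaussianReal 0 1) j₀).measure_preimage
      hB₂'.nullMeasurableSet]
    refine (measure_lt_abs_gaussianReal_le (by norm_num)).trans (ENNReal.ofReal_le_ofReal ?_)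
    have h1 : -(10 : ℝ) ^ 2 / 2 = -50 := by norm_num
    rw [h1, Real.exp_neg]
    have h2 := Real.add_one_le_exp (50 : ℝ)
    have h3 : (Real.exp 50)⁻¹ ≤ (50 + 1 : ℝ)⁻¹ := inv_anti₀ (by norm_num) h2
    norm_num at h3 ⊢
    linarith
  have m₁' : μ.prod ν (B₁ ×ˢ Set.univ) ≤ ENNReal.ofReal (1 / 8) := by
    rw [Measure.prod_prod]; simpa using m₁
  have m₂' : μ.prod ν (B₂ ×ˢ Set.univ) ≤ ENNReal.ofReal (1 / 8) := by
    rw [Measure.prod_prod]; simpa using m₂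
  have m₃ : μ.prod ν B₃ ≤ ENNReal.ofReal (1 / 8) :=
    prod_apply_le_of_forall_section_le μ ν hB₃ fun g =>
      measure_atypicalRows_le_eighth hL hexp hm0 (restrictTo S g)
  have m₄ : μ.prod ν B₄ ≤ ENNReal.ofReal (1 / 8) :=
    prod_apply_le_of_forall_section_le μ ν hB₄ fun g =>
      measure_atypicalRows_le_eighth hL hexp hm0 (Pi.single j₀ 1)
  let Bad := (B₁ ×ˢ Set.univ ∪ B₂ ×ˢ Set.univ) ∪ (B₃ ∪ B₄)
  have hBad : MeasurableSet Bad :=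
    ((hB₁.prod MeasurableSet.univ).union (hB₂.prod MeasurableSet.univ)).union (hB₃.union hB₄)
  have hsub : {X : Fin k → Euc (m + 1) |
      Module.finrank ℝ (Submodule.span ℝ (Set.range X)) = k ∧
      IsEuclideanSection (truncatedCube 0 (4 * √L / √(m + 1))) (Submodule.span ℝ (Set.range X)) ε} ⊆
      splitRows m k ⁻¹' Bad := by
    rintro X ⟨-, hX⟩
    by_contra hgood
    simp only [Bad, Set.mem_preimage, Set.mem_union, not_or, Set.mem_prod, Set.mem_univ,
      and_true] at hgood
    obtain ⟨⟨g₁, g₂⟩, g₃, g₄⟩ := hgood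
    have g₁' : |∑ j ∈ S, X j 0 ^ 2 - k₀| < 1 / 2 * k₀ := by
      simpa [B₁, splitRows, hS] using g₁
    have g₂' : |X j₀ 0| ≤ 10 := by
      simpa [B₂, splitRows] using g₂
    rw [abs_lt] at g₁'
    exact not_isEuclideanSection_of_typical X S j₀ hε hε1 hm0 hL
      hLm (by linarith [g₁'.1]) (by linarith [g₁'.2]) (by linarith [g₁'.1]) g₂' g₃ g₄ hX
  refine (measure_mono hsub).trans ?_
  rw [(measurePreserving_splitRows m k).measure_preimage hBad.nullMeasurableSet]
  refine (measure_union_le _ _).trans ((add_le_add ((measure_union_le _ _).trans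
    (add_le_add m₁' m₂')) ((measure_union_le _ _).trans (add_le_add m₃ m₄))).trans ?_)
  rw [← ENNReal.ofReal_add (by norm_num) (by norm_num),
    ← ENNReal.ofReal_add (by norm_num) (by norm_num)]
  refine le_of_eq ?_
  rw [show (1 / 8 + 1 / 8 + (1 / 8 + 1 / 8) : ℝ) = 1 / 2 by norm_num,
    ENNReal.ofReal_div_of_pos (by norm_num)]
  simp

/-- **Optimality of the randomized Dvoretzky theorem in John's position.**
The random `k`-dimensional subspace distributed according to the rotation-invariant (Haar)
measure is realized as the span of `k` i.i.d. standard Gaussian vectors. -/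
theorem john_position_poor_concentration :
    ∃ (c C : ℝ) (n₀ : ℕ), 0 < c ∧ 0 < C ∧ ∀ n : ℕ, n₀ ≤ n →
      ∃ B : Set (Euc n), IsSymmConvexBody B ∧ IsJohnPosition B ∧ StdUncond B ∧
        ∀ ε : ℝ, 0 < ε → ε ≤ c →
        ∀ k : ℕ, C * max (ε ^ 2 * Real.log n) 1 ≤ (k : ℝ) →
          (Measure.pi fun _ : Fin k => stdGaussian n)
            {X : Fin k → Euc n |
              Module.finrank ℝ (Submodule.span ℝ (Set.range X)) = k ∧
              IsEuclideanSection B (Submodule.span ℝ (Set.range X)) ε} ≤ 1/2 := by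
  refine ⟨1 / 1000, 2000000, ⌈Real.exp 1000000⌉₊, by norm_num, by norm_num, fun n hn => ?_⟩
  have hn' : Real.exp 1000000 ≤ n := Nat.ceil_le.1 hn
  have hnpos : (0 : ℝ) < n := (Real.exp_pos _).trans_le hn'
  obtain ⟨m, rfl⟩ : ∃ m, n = m + 1 :=
    ⟨n - 1, (Nat.succ_pred_eq_of_pos (by exact_mod_cast hnpos)).symm⟩
  set L := Real.log ((m + 1 : ℕ) : ℝ) with hLdef
  have hexp : Real.exp L = m + 1 := by rw [hLdef, Real.exp_log hnpos]; push_cast; ring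
  have hL : 1000000 ≤ L := (Real.le_log_iff_exp_le hnpos).2 hn'
  have hLm : 200 * L + 1 ≤ m := by
    have h1 := Real.quadratic_le_exp_of_nonneg (x := L) (by linarith)
    rw [hexp] at h1
    nlinarith
  set N : ℝ := √(m + 1) with hN
  have hN0 : 0 < N := by positivity
  have ha0 : 0 < 4 * √L / N := by
    have : 0 < √L := Real.sqrt_pos.2 (by linarith)
    positivity
  have ha : 4 * √L / N ≤ 1 / 2 := by
    rw [div_le_iff₀ hN0]
    refine le_of_sq_le_sq ?_ (by positivity)
    rw [mul_pow, mul_pow, Real.sq_sqrt (by linarith), hN, Real.sq_sqrt (by positivity)]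
    linarith
  refine ⟨truncatedCube 0 (4 * √L / N), isSymmConvexBody_truncatedCube 0 ha0 ha,
    isJohnPosition_truncatedCube 0 ha, stdUncond_truncatedCube 0 _, fun ε hε hεc k hk => ?_⟩
  set k₀ := ⌈2000000 * max (ε ^ 2 * L) 1⌉₊ with hk₀
  have hk₀k : k₀ ≤ k := Nat.ceil_le.2 hk
  have hk₀l : 2000000 * max (ε ^ 2 * L) 1 ≤ k₀ := Nat.le_ceil _
  have hk₀u : (k₀ : ℝ) < 2000000 * max (ε ^ 2 * L) 1 + 1 := Nat.ceil_lt_add_one (by positivity)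
  have hmax1 := le_max_left (ε ^ 2 * L) 1
  have hmax2 := le_max_right (ε ^ 2 * L) 1
  have hmax3 : max (ε ^ 2 * L) 1 ≤ ε ^ 2 * L + 1 :=
    max_le (by linarith) (by linarith [mul_nonneg (sq_nonneg ε) (by linarith : 0 ≤ L)])
  have hεL : ε ^ 2 * L ≤ (1 / 1000) ^ 2 * L :=
    mul_le_mul_of_nonneg_right (pow_le_pow_left₀ hε.le hεc 2) (by linarith)
  have hk₀1 : (2000000 : ℝ) ≤ k₀ := by linarith
  exact measure_isEuclideanSection_truncatedCube_le hk₀k (by linarith) hexp (by linarith)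
    (by linarith) hε (by linarith) (by linarith) (by linarith) (by linarith)
end
end

section
/- Let B be a convex body in ℝⁿ with a smooth boundary such that the standard basis e₁,…,eₙ is 1-unconditional with respect to ‖·‖_B, and let G be the standard Gaussian vector in ℝⁿ. Then for any p ≥ 1, E‖grad_B(G)‖₁^p = E(Σᵢ₌₁ⁿ |⟨grad_B(G), eᵢ⟩|)^p ≤ (π/2)^{p/2} · E‖G‖_B^p. -/
open MeasureTheory ProbabilityTheory Real
open scoped ENNReal RealInnerProductSpace

noncomputable section

/-- The coordinates of a standard Gaussian vector are standard Gaussian variables. -/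
lemma measurePreserving_coord_stdGaussian {n : ℕ} (i : Fin n) :
    MeasurePreserving (fun x : Euc n => x i) (stdGaussian n) (gaussianReal 0 1) := by
  refine ⟨by fun_prop, ?_⟩
  rw [_root_.stdGaussian, Measure.map_map (by fun_prop) (ContinuousLinearEquiv.continuous _).measurable]
  exact (measurePreserving_eval (fun _ : Fin n => gaussianReal 0 1) i).map_eq

instance isProbabilityMeasure_map_stdGaussian (n : ℕ) :
    IsProbabilityMeasure (stdGaussian n) :=
  Measure.isProbabilityMeasure_map (ContinuousLinearEquiv.continuous _).measurable.aemeasurable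

/-- The first absolute moment of a standard Gaussian variable. -/
lemma integral_abs_gaussianReal : ∫ x, |x| ∂gaussianReal 0 1 = 2 / √(2 * π) := by
  rw [integral_gaussianReal_eq_integral_smul one_ne_zero]
  have h1 : ∀ x : ℝ, gaussianPDFReal 0 1 x • |x|
      = (fun y => (√(2 * π))⁻¹ * (y ^ (1 : ℝ) * rexp (-(1 / 2) * y ^ (2 : ℝ)))) |x| := by
    intro x
    simp only [gaussianPDFReal, NNReal.coe_one, mul_one, sub_zero, smul_eq_mul, rpow_one,
      rpow_two, sq_abs]
    rw [show -x ^ 2 / 2 = -(1 / 2) * x ^ 2 by ring]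
    ring
  simp_rw [h1]
  rw [integral_comp_abs
      (f := fun y => (√(2 * π))⁻¹ * (y ^ (1 : ℝ) * rexp (-(1 / 2) * y ^ (2 : ℝ)))),
    integral_const_mul,
    integral_rpow_mul_exp_neg_mul_rpow (by norm_num) (by norm_num) (by norm_num)]
  norm_num [rpow_neg_one]
  ring

/-- A supporting hyperplane bound: the derivative of a gauge at any point is dominated by the
gauge itself. -/
lemma inner_gradient_gauge_le {n : ℕ} {B : Set (Euc n)} (hB : IsSymmConvexBody B)
    {x g : Euc n} (hg : HasGradientAt (gauge B) g x) (y : Euc n) :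
    (inner ℝ g y) ≤ gauge B y := by
  have habs : Absorbent ℝ B := absorbent_nhds_zero (mem_interior_iff_mem_nhds.1 hB.2.2.1)
  have hline : HasLineDerivAt ℝ (gauge B) (inner ℝ g y) x y := by
    simpa using hg.hasFDerivAt.hasLineDerivAt y
  refine le_of_tendsto hline.tendsto_slope_zero_right ?_
  filter_upwards [self_mem_nhdsWithin] with t ht
  have ht : 0 < t := ht
  have h := gauge_add_le hB.2.1 habs x (t • y)
  rw [gauge_smul_of_nonneg ht.le, smul_eq_mul] at h
  rw [smul_eq_mul, inv_mul_le_iff₀ ht]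
  linarith

lemma sum_abs_gradient_mul_abs_le {n : ℕ} {B : Set (Euc n)} (hB : IsSymmConvexBody B)
    (hU : StdUncond B) {x g : Euc n} (hg : HasGradientAt (gauge B) g x) (y : Euc n) :
    ∑ i, |g i| * |y i| ≤ gauge B y := by
  set σ : Fin n → ℝ := fun i => if 0 ≤ g i * y i then 1 else -1 with hσ
  have hσ' : ∀ i, σ i = 1 ∨ σ i = -1 := fun i => by
    simp only [hσ]; split_ifs <;> simp
  have h := inner_gradient_gauge_le hB hg
    ((EuclideanSpace.equiv (Fin n) ℝ).symm fun i => σ i * y i)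
  rw [hU _ σ hσ'] at h
  refine le_trans (le_of_eq ?_) h
  rw [PiLp.inner_apply]
  refine Finset.sum_congr rfl fun i _ => ?_
  rw [← abs_mul]
  change |g i * y i| = σ i * y i * g i
  simp only [hσ]
  split_ifs with hi
  · rw [abs_of_nonneg hi]; ring
  · rw [abs_of_neg (not_le.1 hi)]; ring

lemma memLp_gauge_stdGaussian {n : ℕ} {B : Set (Euc n)} (hB : IsSymmConvexBody B)
    {q : ℝ≥0∞} (hq : q ≠ ∞) : MemLp (gauge B) q (stdGaussian n) := by
  have h0 : B ∈ nhds (0 : Euc n) := mem_interior_iff_mem_nhds.1 hB.2.2.1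
  obtain ⟨r, hr, hrB⟩ := Metric.mem_nhds_iff.1 h0
  have hcoord : MemLp (fun x : Euc n => ∑ i, ‖x i‖) q (stdGaussian n) :=
    memLp_finsetSum _ fun i _ =>
      ((memLp_id_gaussianReal' q hq).comp_measurePreserving
        (measurePreserving_coord_stdGaussian i)).norm
  refine (hcoord.const_mul r⁻¹).of_le
    (continuous_gauge hB.2.1 h0).aestronglyMeasurable (.of_forall fun x => ?_)
  have h1 : r * gauge B x ≤ ‖x‖ := mul_gauge_le_norm hrB
  have h2 : ‖x‖ ≤ ∑ i, ‖x i‖ := by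
    rw [EuclideanSpace.norm_eq]
    refine sqrt_le_iff.2 ⟨by positivity, Finset.sum_sq_le_sq_sum_of_nonneg fun i _ => by positivity⟩
  rw [norm_of_nonneg (gauge_nonneg x), norm_of_nonneg (by positivity), ← div_eq_inv_mul,
    le_div_iff₀' hr]
  exact h1.trans h2

/-- The `ℓ₁`-norm of the gradient of the gauge is bounded pointwise by a multiple of the Gaussian
mean of the gauge. -/
lemma sum_abs_gradient_le {n : ℕ} {B : Set (Euc n)} (hB : IsSymmConvexBody B)
    (hU : StdUncond B) {x g : Euc n} (hg : HasGradientAt (gauge B) g x) :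
    ∑ i, |g i| ≤ √(π / 2) * ∫ y, gauge B y ∂stdGaussian n := by
  have hcoord : ∀ i : Fin n, Integrable (fun y : Euc n => |y i|) (stdGaussian n) := fun i =>
    ((memLp_id_gaussianReal' 1 ENNReal.one_ne_top).comp_measurePreserving
      (measurePreserving_coord_stdGaussian i)).integrable le_rfl |>.abs
  have hmean : ∀ i : Fin n, ∫ y : Euc n, |y i| ∂stdGaussian n = 2 / √(2 * π) := fun i => by
    rw [← integral_abs_gaussianReal, ← (measurePreserving_coord_stdGaussian i).map_eq,
      integral_map (by fun_prop) (by fun_prop)]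
  have hle : ∫ y : Euc n, ∑ i, |g i| * |y i| ∂stdGaussian n ≤ ∫ y, gauge B y ∂stdGaussian n :=
    integral_mono (integrable_finsetSum _ fun i _ => (hcoord i).const_mul _)
      ((memLp_gauge_stdGaussian hB ENNReal.one_ne_top).integrable le_rfl)
      fun y => sum_abs_gradient_mul_abs_le hB hU hg y
  rw [integral_finsetSum _ fun i _ => (hcoord i).const_mul _] at hle
  simp_rw [integral_const_mul, hmean, ← Finset.sum_mul] at hle
  have hconst : √(π / 2) * (2 / √(2 * π)) = 1 := by
    have h4 : √(2 * π) = 2 * √(π / 2) := by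
      rw [show 2 * π = 2 ^ 2 * (π / 2) by ring, sqrt_mul (by norm_num), sqrt_sq (by norm_num)]
    have hpos : 0 < √(π / 2) := sqrt_pos.2 (by positivity)
    rw [h4]
    field_simp
  calc ∑ i, |g i| = √(π / 2) * ((∑ i, |g i|) * (2 / √(2 * π))) := by
        rw [mul_left_comm, hconst, mul_one]
    _ ≤ _ := mul_le_mul_of_nonneg_left hle (sqrt_nonneg _)

lemma ae_ne_zero_stdGaussian {n : ℕ} (i : Fin n) : ∀ᵐ x ∂stdGaussian n, x ≠ 0 := by
  have : NullSingletonClass (gaussianReal 0 1) := nullSingletonClass_gaussianReal one_ne_zero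
  have h : ∀ᵐ t ∂gaussianReal 0 1, t ≠ 0 := by simp [ae_iff]
  filter_upwards [(measurePreserving_coord_stdGaussian i).quasiMeasurePreserving.ae h] with x hx h0
  exact hx (by simp [h0])

/-- **ℓ₁-bound for the gradient**: for a smooth convex body whose standard basis is
`1`-unconditional, `E‖grad_B(G)‖₁^p = E(Σᵢ |⟨grad_B(G), eᵢ⟩|)^p ≤ (π/2)^{p/2}·E‖G‖_B^p`. -/
theorem grad_l1_bound :
    ∀ n : ℕ, ∀ B : Set (Euc n), IsSymmConvexBody B → StdUncond B →
    ∀ gradB : Euc n → Euc n,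
      (∀ x : Euc n, x ≠ 0 → HasGradientAt (gauge B) (gradB x) x) →
    ∀ p : ℝ, 1 ≤ p →
      (∫ x, (∑ i, |gradB x i|) ^ p ∂stdGaussian n) ≤
        (Real.pi / 2) ^ (p / 2) * ∫ x, gauge B x ^ p ∂stdGaussian n := by
  intro n B hB hU gradB hgrad p hp
  have hp0 : 0 < p := by linarith
  set M := ∫ x, gauge B x ∂stdGaussian n with hM
  have hM0 : 0 ≤ M := integral_nonneg fun x => gauge_nonneg x
  have hpt : ∀ᵐ x ∂stdGaussian n, ∑ i, |gradB x i| ≤ √(π / 2) * M := by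
    rcases Nat.eq_zero_or_pos n with rfl | hn
    · refine .of_forall fun x => ?_
      simp only [Finset.univ_eq_empty, Finset.sum_empty]
      positivity
    · filter_upwards [ae_ne_zero_stdGaussian ⟨0, hn⟩] with x hx
      exact sum_abs_gradient_le hB hU (hgrad x hx)
  have hint : Integrable (fun x => gauge B x ^ p) (stdGaussian n) := by
    have h := (memLp_gauge_stdGaussian hB (q := ENNReal.ofReal p)
      ENNReal.ofReal_ne_top).integrable_norm_rpow'
    simpa only [ENNReal.toReal_ofReal hp0.le, norm_of_nonneg (gauge_nonneg _)] using h
  have hjensen : M ^ p ≤ ∫ x, gauge B x ^ p ∂stdGaussian n :=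
    (convexOn_rpow hp).map_integral_le (continuousOn_id.rpow_const fun _ _ => .inr hp0.le)
      isClosed_Ici (.of_forall fun x => gauge_nonneg x)
      ((memLp_gauge_stdGaussian hB ENNReal.one_ne_top).integrable le_rfl) hint
  calc ∫ x, (∑ i, |gradB x i|) ^ p ∂stdGaussian n
      ≤ ∫ _, (√(π / 2) * M) ^ p ∂stdGaussian n := by
        refine integral_mono_of_nonneg (.of_forall fun x => by positivity)
          (integrable_const _) ?_
        filter_upwards [hpt] with x hx
        exact rpow_le_rpow (by positivity) hx hp0.le
    _ = (π / 2) ^ (p / 2) * M ^ p := by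
        rw [integral_const, probReal_univ, one_smul, mul_rpow (sqrt_nonneg _) hM0,
          sqrt_eq_rpow, ← rpow_mul (by positivity)]
        congr 2
        ring
    _ ≤ _ := mul_le_mul_of_nonneg_left hjensen (by positivity)
end
end

section
/- Let B ⊂ ℝⁿ be an origin-symmetric convex body with a smooth boundary in the ℓ-position. Then for every unit vector u ∈ S^{n−1}, E(‖G‖_B · ⟨grad_B(G), u⟩ · ⟨G, u⟩) = (1/n) · E‖G‖_B² = 1/n, where G is the standard Gaussian vector in ℝⁿ. -/
open MeasureTheory ProbabilityTheory Real
open scoped ENNReal RealInnerProductSpace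

noncomputable section

lemma integrable_norm_sq_stdGaussian (n : ℕ) :
    Integrable (fun x : Euc n => ‖x‖ ^ 2) (_root_.stdGaussian n) := by
  have hm : Measurable ((EuclideanSpace.equiv (Fin n) ℝ).symm) :=
    (EuclideanSpace.equiv (Fin n) ℝ).symm.continuous.measurable
  have hsq : Integrable (fun y : ℝ => y ^ 2) (gaussianReal 0 1) :=
    (memLp_id_gaussianReal (μ := 0) (v := 1) 2).integrable_sq
  rw [_root_.stdGaussian, integrable_map_measure (by fun_prop) hm.aemeasurable]
  have heq : (fun x : Euc n => ‖x‖ ^ 2) ∘ (EuclideanSpace.equiv (Fin n) ℝ).symm =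
      fun y : Fin n → ℝ => ∑ i, y i ^ 2 := by
    ext y
    simp [EuclideanSpace.norm_sq_eq]
  rw [heq]
  exact integrable_finsetSum _ fun i _ =>
    integrable_comp_eval (μ := fun _ : Fin n => gaussianReal 0 1) (i := i) hsq

/-- Differentiation under the integral sign along the rank-one perturbation
`x ↦ x + t ⟪u, x⟫ u` for a Lipschitz function `p` vanishing at the origin. -/
lemma hasDerivAt_integral_sq_rankOne {n : ℕ} {μ : Measure (Euc n)}
    (hμ : Integrable (fun x : Euc n => ‖x‖ ^ 2) μ) {p : Euc n → ℝ} {K : NNReal}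
    (hp : LipschitzWith K p) (hp0 : p 0 = 0) {g : Euc n → Euc n}
    (hg : ∀ x, x ≠ 0 → HasGradientAt p (g x) x) {u : Euc n} (hu : ‖u‖ = 1) :
    HasDerivAt (fun t : ℝ => ∫ x, p (x + (t * ⟪u, x⟫) • u) ^ 2 ∂μ)
      (∫ x, 2 * (p x * ⟪g x, u⟫ * ⟪x, u⟫) ∂μ) 0 := by
  have hcont : Continuous (Function.uncurry fun (x : Euc n) (t : ℝ) =>
      p (x + (t * ⟪u, x⟫) • u) ^ 2) := by
    have := hp.continuous
    unfold Function.uncurry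
    fun_prop
  have hbound (x : Euc n) : |p x| ≤ K * ‖x‖ := by
    simpa [hp0, dist_eq_norm] using hp.dist_le_mul x 0
  have hinner (x : Euc n) : |⟪u, x⟫| ≤ ‖x‖ := by
    simpa [hu] using abs_real_inner_le_norm u x
  have hderiv (x : Euc n) : HasDerivAt (fun t : ℝ => p (x + (t * ⟪u, x⟫) • u) ^ 2)
      (2 * (p x * ⟪g x, u⟫ * ⟪x, u⟫)) 0 := by
    rcases eq_or_ne x 0 with rfl | hx
    · simpa [hp0] using hasDerivAt_const (0 : ℝ) (0 : ℝ)
    · have hline : HasDerivAt (fun t : ℝ => x + (t * ⟪u, x⟫) • u) (⟪u, x⟫ • u) 0 := by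
        simpa using (((hasDerivAt_id (0 : ℝ)).mul_const ⟪u, x⟫).smul_const u).const_add x
      have hp' : HasFDerivAt p (InnerProductSpace.toDual ℝ (Euc n) (g x))
          (x + ((0 : ℝ) * ⟪u, x⟫) • u) := by
        simpa using (hg x hx).hasFDerivAt
      refine ((hp'.comp_hasDerivAt (0 : ℝ) hline).pow 2).congr_deriv ?_
      simp [real_inner_comm]
      ring
  refine (hasDerivAt_integral_of_dominated_loc_of_lip
    (F := fun (t : ℝ) (x : Euc n) => p (x + (t * ⟪u, x⟫) • u) ^ 2)
    (bound := fun x => 4 * K ^ 2 * ‖x‖ ^ 2) (Metric.ball_mem_nhds (0 : ℝ) one_pos)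
    ?_ ?_ ?_ ?_ (hμ.const_mul _) (.of_forall hderiv)).2
  · exact .of_forall fun t =>
      (hcont.comp (continuous_id.prodMk continuous_const)).aestronglyMeasurable
  · refine (hμ.const_mul ((K : ℝ) ^ 2)).mono' ?_ (.of_forall fun x => ?_)
    · exact (hcont.comp (continuous_id.prodMk continuous_const)).aestronglyMeasurable
    · have := pow_le_pow_left₀ (abs_nonneg _) (hbound x) 2
      simpa [mul_pow] using this
  · have hmeas := (measurable_deriv_with_param hcont).comp
      (measurable_id.prodMk (measurable_const (a := (0 : ℝ))))
    have heq : (fun x => 2 * (p x * ⟪g x, u⟫ * ⟪x, u⟫)) =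
        (fun q : Euc n × ℝ => deriv (fun t : ℝ => p (q.1 + (t * ⟪u, q.1⟫) • u) ^ 2) q.2) ∘
          fun x => (id x, (0 : ℝ)) := by
      ext x
      exact (hderiv x).deriv.symm
    rw [heq]
    exact hmeas.aestronglyMeasurable
  · refine .of_forall fun x => LipschitzOnWith.of_dist_le_mul fun t ht s hs => ?_
    have hsize {r : ℝ} (hr : r ∈ Metric.ball (0 : ℝ) 1) :
        |p (x + (r * ⟪u, x⟫) • u)| ≤ K * (2 * ‖x‖) := by
      refine (hbound _).trans (mul_le_mul_of_nonneg_left ?_ K.2)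
      have hr' : |r| ≤ 1 := by simpa using (mem_ball_zero_iff.1 hr).le
      have h1 : ‖(r * ⟪u, x⟫) • u‖ ≤ ‖x‖ := by
        rw [norm_smul, hu, mul_one, norm_mul]
        calc |r| * |⟪u, x⟫| ≤ 1 * ‖x‖ :=
              mul_le_mul hr' (hinner x) (abs_nonneg _) zero_le_one
          _ = ‖x‖ := one_mul _
      linarith [norm_add_le x ((r * ⟪u, x⟫) • u)]
    have hdiff : |p (x + (t * ⟪u, x⟫) • u) - p (x + (s * ⟪u, x⟫) • u)| ≤
        K * (|t - s| * ‖x‖) := by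
      refine (hp.dist_le_mul _ _).trans (mul_le_mul_of_nonneg_left ?_ K.2)
      rw [dist_add_left, dist_eq_norm, ← sub_smul, ← sub_mul, norm_smul, hu, mul_one, norm_mul]
      exact mul_le_mul_of_nonneg_left (hinner x) (abs_nonneg _)
    have hsum := (abs_add_le (p (x + (t * ⟪u, x⟫) • u)) (p (x + (s * ⟪u, x⟫) • u))).trans
      (add_le_add (hsize ht) (hsize hs))
    rw [Real.dist_eq, Real.dist_eq, sq_sub_sq, abs_mul]
    refine (mul_le_mul hsum hdiff (abs_nonneg _) (by positivity)).trans_eq ?_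
    rw [Real.coe_nnabs, abs_of_nonneg (show 0 ≤ 4 * (K : ℝ) ^ 2 * ‖x‖ ^ 2 by positivity)]
    ring

/-- In the ℓ-position, `|det U|² ≤ ℓ(B, U)^{2n}` for every `U` with `ℓ(B, U) > 0`. -/
lemma IsEllPosition.det_sq_le {n : ℕ} {B : Set (Euc n)} (hB : IsEllPosition B)
    (U : Euc n →ₗ[ℝ] Euc n) (hU : 0 < ∫ x, gauge B (U x) ^ 2 ∂_root_.stdGaussian n) :
    LinearMap.det U ^ 2 ≤ (∫ x, gauge B (U x) ^ 2 ∂_root_.stdGaussian n) ^ n := by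
  set s := ∫ x, gauge B (U x) ^ 2 ∂_root_.stdGaussian n with hs
  have hr : 0 < √s := Real.sqrt_pos.2 hU
  have hscale : ∫ x, gauge B (((√s)⁻¹ • U) x) ^ 2 ∂_root_.stdGaussian n = 1 := by
    simp_rw [LinearMap.smul_apply, gauge_smul_of_nonneg (inv_nonneg.2 hr.le), smul_eq_mul,
      mul_pow]
    rw [integral_const_mul, ← hs, inv_pow, Real.sq_sqrt hU.le, inv_mul_cancel₀ hU.ne']
  have hdet := hB.2 _ hscale.le
  rw [LinearMap.det_smul, finrank_euclideanSpace_fin, abs_mul, inv_pow, abs_inv,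
    abs_of_pos (pow_pos hr n), inv_mul_le_one₀ (pow_pos hr n)] at hdet
  calc LinearMap.det U ^ 2 = |LinearMap.det U| ^ 2 := (sq_abs _).symm
    _ ≤ (√s ^ n) ^ 2 := pow_le_pow_left₀ (abs_nonneg _) hdet 2
    _ = s ^ n := by rw [← pow_mul, mul_comm, pow_mul, Real.sq_sqrt hU.le]

/-- **Balancing identity in the ℓ-position**: for a smooth origin-symmetric convex body in
the ℓ-position and any unit vector `u`,
`E(‖G‖_B ⟨grad_B(G), u⟩ ⟨G, u⟩) = (1/n)·E‖G‖_B² = 1/n`. -/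
theorem ell_position_balancing :
    ∀ n : ℕ, 0 < n → ∀ B : Set (Euc n), IsSymmConvexBody B → IsEllPosition B →
    ∀ gradB : Euc n → Euc n,
      (∀ x : Euc n, x ≠ 0 → HasGradientAt (gauge B) (gradB x) x) →
    ∀ u : Euc n, ‖u‖ = 1 →
      (∫ x, gauge B x * ⟪gradB x, u⟫ * ⟪x, u⟫ ∂stdGaussian n) =
        (1 / n) * (∫ x, gauge B x ^ 2 ∂stdGaussian n) ∧
      (∫ x, gauge B x * ⟪gradB x, u⟫ * ⟪x, u⟫ ∂stdGaussian n) = 1 / n := by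
  intro n hn B hB hell gradB hgrad u hu
  obtain ⟨-, hconv, hint, -⟩ := hB
  obtain ⟨K, hK⟩ := hconv.lipschitz_gauge (mem_interior_iff_mem_nhds.1 hint)
  have hn' : (n : ℝ) ≠ 0 := by exact_mod_cast hn.ne'
  have hderiv := hasDerivAt_integral_sq_rankOne (integrable_norm_sq_stdGaussian n) hK
    gauge_zero hgrad hu
  rw [integral_const_mul] at hderiv
  set I := ∫ x, gauge B x * ⟪gradB x, u⟫ * ⟪x, u⟫ ∂_root_.stdGaussian n
  set φ : ℝ → ℝ := fun t => ∫ x, gauge B (x + (t * ⟪u, x⟫) • u) ^ 2 ∂_root_.stdGaussian n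
    with hφ
  have hφ0 : φ 0 = 1 := by simpa [hφ] using hell.1
  have hdet (t : ℝ) (ht : 0 < φ t) : (1 + t) ^ 2 ≤ φ t ^ n := by
    have h := hell.det_sq_le (LinearMap.transvection (t • innerₗ (Euc n) u) u)
    simp only [LinearMap.transvection.det, LinearMap.transvection.apply, LinearMap.smul_apply,
      innerₗ_apply_apply, real_inner_self_eq_norm_sq, hu, smul_eq_mul, one_pow, mul_one] at h
    exact h ht
  have hmin : IsLocalMin (fun t : ℝ => φ t ^ n - (1 + t) ^ 2) 0 := by
    filter_upwards [hderiv.continuousAt.eventually (lt_mem_nhds (show 0 < φ 0 by simp [hφ0]))]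
      with t ht
    simpa [hφ0] using hdet t ht
  have hder : HasDerivAt (fun t : ℝ => φ t ^ n - (1 + t) ^ 2) (n * (2 * I) - 2) 0 := by
    refine ((hderiv.pow n).sub (((hasDerivAt_id (0 : ℝ)).const_add 1).pow 2)).congr_deriv ?_
    simp [hφ0]
  have hI : I = 1 / n := by
    have := hmin.hasDerivAt_eq_zero hder
    field_simp
    linarith
  exact ⟨by rw [hell.1, mul_one, hI], hI⟩
end
end

section
/- For any δ > 0 and p ∈ [1, ∞) there exist n₀ = n₀(δ) ∈ ℕ depending only on δ and c_{δ,p} > 0 depending only on δ and p with the following property: if n ≥ n₀ and B is an origin-symmetric convex body in ℝⁿ such that P{‖g·x‖_B^p ≥ E‖G‖_B^p} ≤ n^{−δ} for every unit vector x ∈ S^{n−1} (where g is a standard real Gaussian variable and G the standard Gaussian vector in ℝⁿ), then E‖G‖_B / Lip(‖·‖_B) ≥ c_{δ,p}·√(log n). -/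
open MeasureTheory ProbabilityTheory Real
open scoped ENNReal NNReal RealInnerProductSpace

noncomputable section

namespace MomentComparison

open ProbabilityTheory.Fernique

/-- Powers are dominated by Gaussian exponentials. -/
lemma exists_rpow_le_mul_exp_sq {p C : ℝ} (hp : 0 ≤ p) (hC : 0 < C) :
    ∃ A : ℝ, 0 < A ∧ ∀ t : ℝ, 0 ≤ t → t ^ p ≤ A * rexp (C * t ^ 2) := by
  obtain ⟨m, hm⟩ := exists_nat_ge p
  refine ⟨1 + m.factorial / C ^ m, by positivity, fun t ht ↦ ?_⟩
  have h_pow : t ^ p ≤ 1 + (t ^ 2) ^ m := by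
    rcases le_total t 1 with h | h
    · exact (Real.rpow_le_one ht h hp).trans (by simpa using by positivity)
    · calc t ^ p ≤ t ^ ((2 * m : ℕ) : ℝ) := by
            refine Real.rpow_le_rpow_of_exponent_le h ?_
            push_cast
            have : (0 : ℝ) ≤ m := by positivity
            linarith
        _ = (t ^ 2) ^ m := by rw [Real.rpow_natCast, pow_mul]
        _ ≤ 1 + (t ^ 2) ^ m := by linarith
  have h_exp := Real.pow_div_factorial_le_exp (x := C * t ^ 2) (by positivity) m
  have h_one : 1 ≤ rexp (C * t ^ 2) := Real.one_le_exp (by positivity)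
  have h_sq : (t ^ 2) ^ m = m.factorial / C ^ m * ((C * t ^ 2) ^ m / m.factorial) := by
    rw [mul_pow]
    field_simp
  calc t ^ p ≤ 1 + m.factorial / C ^ m * ((C * t ^ 2) ^ m / m.factorial) := h_sq ▸ h_pow
    _ ≤ rexp (C * t ^ 2) + m.factorial / C ^ m * rexp (C * t ^ 2) := by gcongr
    _ = (1 + m.factorial / C ^ m) * rexp (C * t ^ 2) := by ring

/-- The dimension-free bound on Gaussian exponential moments in Fernique's theorem is finite. -/
lemma fernique_bound_ne_top {c : ℝ≥0∞} (hc_gt : 2⁻¹ < c) (hc_lt : c < 1) :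
    ENNReal.ofReal (rexp (logRatio c))
      + ∑' n : ℕ, .ofReal (rexp (-2⁻¹ * Real.log (c / (1 - c)).toReal * 2 ^ n)) ≠ ∞ := by
  have h_sub : 1 - c < c := by
    refine ENNReal.sub_lt_of_lt_add hc_lt.le ?_
    rw [← two_mul]
    rwa [inv_eq_one_div, ENNReal.div_lt_iff (by simp) (by simp), mul_comm] at hc_gt
  have hc_top : c ≠ ∞ := (hc_lt.trans ENNReal.one_lt_top).ne
  have h_sub_top : 1 - c ≠ ∞ := (h_sub.trans_le le_top).ne
  have h_pos : 0 < (1 - c).toReal := ENNReal.toReal_pos (tsub_pos_of_lt hc_lt).ne' h_sub_top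
  refine ENNReal.add_ne_top.mpr ⟨ENNReal.ofReal_ne_top, ?_⟩
  refine (Summable.tsum_ofReal_lt_top <| Real.summable_exp_nat_mul_of_ge ?_
    (fun i ↦ mod_cast (Nat.lt_pow_self (by simp)).le)).ne
  refine mul_neg_of_neg_of_pos (by simp) (Real.log_pos ?_)
  rw [ENNReal.toReal_div, one_lt_div h_pos]
  exact (ENNReal.toReal_lt_toReal h_sub_top hc_top).2 h_sub

/-- **Kahane–Khinchine inequality** for rotation-invariant measures: the `p`-th moment of the norm
is controlled by the first moment, with a constant depending only on `p`. -/
theorem exists_integral_norm_rpow_le {p : ℝ} (hp : 1 ≤ p) :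
    ∃ K : ℝ, 0 < K ∧ ∀ (E : Type) [SeminormedAddCommGroup E] [NormedSpace ℝ E]
      [SecondCountableTopology E] [MeasurableSpace E] [BorelSpace E] (μ : Measure E)
      [IsProbabilityMeasure μ],
      (μ.prod μ).map (ContinuousLinearMap.rotation (-(π / 4))) = μ.prod μ →
      Integrable (fun x ↦ ‖x‖) μ → ∫ x, ‖x‖ ^ p ∂μ ≤ (K * ∫ x, ‖x‖ ∂μ) ^ p := by
  have hp0 : 0 < p := by linarith
  let c : ℝ≥0∞ := ENNReal.ofReal (3 / 4)
  have hc_gt : 2⁻¹ < c := by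
    rw [show (2⁻¹ : ℝ≥0∞) = ENNReal.ofReal 2⁻¹ by
      rw [ENNReal.ofReal_inv_of_pos two_pos, ENNReal.ofReal_ofNat]]
    exact (ENNReal.ofReal_lt_ofReal_iff (by norm_num)).2 (by norm_num)
  have hc_lt : c < 1 := by
    rw [← ENNReal.ofReal_one]
    exact (ENNReal.ofReal_lt_ofReal_iff (by norm_num)).2 (by norm_num)
  obtain ⟨A, hA_pos, hA⟩ := exists_rpow_le_mul_exp_sq hp0.le (logRatio_pos hc_gt hc_lt)
  set D := ENNReal.ofReal (rexp (logRatio c))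
      + ∑' n : ℕ, .ofReal (rexp (-2⁻¹ * Real.log (c / (1 - c)).toReal * 2 ^ n)) with hD
  have hD_top : D ≠ ∞ := fernique_bound_ne_top hc_gt hc_lt
  have hD_pos : 0 < D.toReal :=
    ENNReal.toReal_pos (add_pos_of_pos_of_nonneg (by positivity) bot_le).ne' hD_top
  refine ⟨4 * (A * D.toReal) ^ p⁻¹, by positivity, fun E _ _ _ _ _ μ _ h_rot h_int ↦ ?_⟩
  have h_nonneg : 0 ≤ ∫ x, ‖x‖ ∂μ := integral_nonneg fun _ ↦ norm_nonneg _
  rcases h_nonneg.eq_or_lt with h_zero | h_pos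
  · have h_ae := (integral_eq_zero_iff_of_nonneg (fun _ ↦ norm_nonneg _) h_int).1 h_zero.symm
    have h_left : ∫ x, ‖x‖ ^ p ∂μ = 0 := by
      refine integral_eq_zero_of_ae ?_
      filter_upwards [h_ae] with x hx
      simp only [Pi.zero_apply] at hx ⊢
      rw [hx, Real.zero_rpow hp0.ne']
    rw [h_left, ← h_zero, mul_zero, Real.zero_rpow hp0.ne']
  set a : ℝ := 4 * ∫ x, ‖x‖ ∂μ with ha
  have ha_pos : 0 < a := by positivity
  have h_meas : MeasurableSet {x : E | ‖x‖ ≤ a} := measurableSet_le (by fun_prop) (by fun_prop)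
  have h_markov : c ≤ μ {x | ‖x‖ ≤ a} := by
    have h := mul_meas_ge_le_integral_of_nonneg (μ := μ) (ae_of_all _ fun x ↦ norm_nonneg x) h_int a
    have h_compl : μ.real {x | ‖x‖ ≤ a}ᶜ ≤ μ.real {x | a ≤ ‖x‖} :=
      measureReal_mono fun x hx ↦ (not_le.1 (Set.notMem_ofPred_iff.1 hx)).le
    rw [probReal_compl_eq_one_sub h_meas] at h_compl
    have h_quarter : μ.real {x | a ≤ ‖x‖} ≤ 1 / 4 := by
      rw [← mul_le_mul_iff_right₀ ha_pos]
      linarith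
    rw [← ofReal_measureReal]
    exact ENNReal.ofReal_le_ofReal (by linarith)
  have h_fernique := lintegral_exp_mul_sq_norm_le_of_map_rotation_eq_self h_rot h_markov hc_gt
  rw [← hD] at h_fernique
  have h_pointwise (x : E) :
      ‖x‖ ^ p ≤ a ^ p * A * rexp (logRatio c * a⁻¹ ^ 2 * ‖x‖ ^ 2) := by
    have h := hA (a⁻¹ * ‖x‖) (by positivity)
    rw [Real.mul_rpow (by positivity) (by positivity), Real.inv_rpow ha_pos.le,
      inv_mul_le_iff₀ (by positivity), mul_pow, ← mul_assoc, ← mul_assoc] at h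
    exact h
  have h_lint : ∫⁻ x, ENNReal.ofReal (‖x‖ ^ p) ∂μ ≤ ENNReal.ofReal (a ^ p * A) * D := by
    calc ∫⁻ x, ENNReal.ofReal (‖x‖ ^ p) ∂μ
        ≤ ∫⁻ x, ENNReal.ofReal (a ^ p * A)
            * ENNReal.ofReal (rexp (logRatio c * a⁻¹ ^ 2 * ‖x‖ ^ 2)) ∂μ := by
          refine lintegral_mono fun x ↦ ?_
          rw [← ENNReal.ofReal_mul (by positivity)]
          exact ENNReal.ofReal_le_ofReal (h_pointwise x)
      _ = ENNReal.ofReal (a ^ p * A)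
            * ∫⁻ x, ENNReal.ofReal (rexp (logRatio c * a⁻¹ ^ 2 * ‖x‖ ^ 2)) ∂μ :=
          lintegral_const_mul' _ _ ENNReal.ofReal_ne_top
      _ ≤ ENNReal.ofReal (a ^ p * A) * D := by gcongr
  calc ∫ x, ‖x‖ ^ p ∂μ = (∫⁻ x, ENNReal.ofReal (‖x‖ ^ p) ∂μ).toReal :=
        integral_eq_lintegral_of_nonneg_ae (ae_of_all _ fun _ ↦ by positivity)
          (Measurable.aestronglyMeasurable (by fun_prop))
    _ ≤ (ENNReal.ofReal (a ^ p * A) * D).toReal :=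
        ENNReal.toReal_mono (ENNReal.mul_ne_top ENNReal.ofReal_ne_top hD_top) h_lint
    _ = a ^ p * (A * D.toReal) := by
        rw [ENNReal.toReal_mul, ENNReal.toReal_ofReal (by positivity), mul_assoc]
    _ = (4 * (A * D.toReal) ^ p⁻¹ * ∫ x, ‖x‖ ∂μ) ^ p := by
        rw [mul_right_comm, ← ha, Real.mul_rpow ha_pos.le (by positivity),
          Real.rpow_inv_rpow (by positivity) hp0.ne']

/-- The space `F` endowed with the seminorm `q`. -/
def SeminormSpace {F : Type} [AddCommGroup F] [Module ℝ F] (_ : Seminorm ℝ F) : Type := F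

section SeminormSpace

variable {F : Type} [AddCommGroup F] [Module ℝ F] (q : Seminorm ℝ F)

instance : SeminormedAddCommGroup (SeminormSpace q) := q.toSeminormedAddCommGroup

instance : Module ℝ (SeminormSpace q) := inferInstanceAs (Module ℝ F)

instance : NormedSpace ℝ (SeminormSpace q) where
  norm_smul_le r x := (map_smul_eq_mul q r x).le

instance : MeasurableSpace (SeminormSpace q) := borel _

instance : BorelSpace (SeminormSpace q) := ⟨rfl⟩

/-- The identity map from `F` to `F` endowed with the seminorm `q`. -/
def toSeminormSpace : F →ₗ[ℝ] SeminormSpace q := LinearMap.id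

lemma norm_toSeminormSpace (x : F) : ‖toSeminormSpace q x‖ = q x := rfl

lemma surjective_toSeminormSpace : Function.Surjective (toSeminormSpace q) := fun x ↦ ⟨x, rfl⟩

end SeminormSpace

lemma continuous_toSeminormSpace {F : Type} [SeminormedAddCommGroup F] [NormedSpace ℝ F]
    {q : Seminorm ℝ F} (hq : Continuous q) : Continuous (toSeminormSpace q) := by
  refine continuous_of_continuousAt_zero (toSeminormSpace q) ?_
  rw [ContinuousAt, map_zero, tendsto_zero_iff_norm_tendsto_zero]
  simpa [norm_toSeminormSpace] using hq.tendsto 0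

/-- **Kahane–Khinchine inequality** for seminorms of a centered Gaussian vector. -/
theorem exists_integral_seminorm_rpow_le {p : ℝ} (hp : 1 ≤ p) :
    ∃ K : ℝ, 0 < K ∧ ∀ (F : Type) [NormedAddCommGroup F] [NormedSpace ℝ F] [CompleteSpace F]
      [SecondCountableTopology F] [MeasurableSpace F] [BorelSpace F] (μ : Measure F)
      [IsGaussian μ], μ[id] = 0 → ∀ q : Seminorm ℝ F, Continuous q → Integrable q μ →
      ∫ x, q x ^ p ∂μ ≤ (K * ∫ x, q x ∂μ) ^ p := by
  obtain ⟨K, hK_pos, hK⟩ := exists_integral_norm_rpow_le hp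
  refine ⟨K, hK_pos, fun F _ _ _ _ _ _ μ _ hμ q hq h_int ↦ ?_⟩
  let T : F →L[ℝ] SeminormSpace q := ⟨toSeminormSpace q, continuous_toSeminormSpace hq⟩
  have hT : Measurable T := T.continuous.measurable
  have : TopologicalSpace.SeparableSpace (SeminormSpace q) :=
    (surjective_toSeminormSpace q).denseRange.separableSpace T.continuous
  have : SecondCountableTopology (SeminormSpace q) := UniformSpace.secondCountable_of_separable _
  have : IsProbabilityMeasure (μ.map T) := Measure.isProbabilityMeasure_map hT.aemeasurable
  have h_rot : ((μ.map T).prod (μ.map T)).map (ContinuousLinearMap.rotation (-(π / 4)))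
      = (μ.map T).prod (μ.map T) := by
    have h_comm : ContinuousLinearMap.rotation (-(π / 4)) ∘ Prod.map T T
        = Prod.map T T ∘ ContinuousLinearMap.rotation (-(π / 4)) := by
      ext x <;> simp [ContinuousLinearMap.rotation_apply]
    rw [Measure.map_prod_map _ _ hT hT, Measure.map_map (by fun_prop) (hT.prodMap hT), h_comm,
      ← Measure.map_map (hT.prodMap hT) (by fun_prop), IsGaussian.map_rotation_eq_self hμ]
  have h := hK (SeminormSpace q) (μ.map T) h_rot
    ((integrable_map_measure (by fun_prop) hT.aemeasurable).2 h_int)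
  rwa [integral_map hT.aemeasurable (Measurable.aestronglyMeasurable (by fun_prop)),
    integral_map hT.aemeasurable (by fun_prop)] at h

end MomentComparison

lemma stdGaussian_eq_stdGaussian_euc (n : ℕ) :
    _root_.stdGaussian n = ProbabilityTheory.stdGaussian (Euc n) :=
  map_pi_eq_stdGaussian

/-- Lower bound on the Gaussian tail. -/
lemma ofReal_exp_le_gaussianReal_Ici {t : ℝ} (ht : 0 ≤ t) :
    ENNReal.ofReal (rexp (-t ^ 2) / 9) ≤ gaussianReal 0 1 (Set.Ici t) := by
  have h_sqrt : √(2 * π * (1 : ℝ≥0)) ≤ 3 := by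
    rw [Real.sqrt_le_left (by norm_num)]
    have := Real.pi_lt_d2
    norm_num
    linarith
  have h_density : ∀ x ∈ Set.Icc t (t + 1), rexp (-t ^ 2) / 9 ≤ gaussianPDFReal 0 1 x := by
    intro x hx
    have h_exp : rexp (-t ^ 2) / 3 ≤ rexp (-(x - 0) ^ 2 / (2 * (1 : ℝ≥0))) := by
      have h_three : rexp 1 ≤ 3 := Real.exp_one_lt_three.le
      calc rexp (-t ^ 2) / 3 ≤ rexp (-t ^ 2) / rexp 1 := by gcongr
        _ = rexp (-t ^ 2 - 1) := (Real.exp_sub _ _).symm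
        _ ≤ rexp (-(x - 0) ^ 2 / (2 * (1 : ℝ≥0))) := by
          refine Real.exp_le_exp.2 ?_
          have : x ^ 2 ≤ (t + 1) ^ 2 := by
            have := hx.1
            have := hx.2
            gcongr
            linarith
          simp only [sub_zero, NNReal.coe_one, mul_one]
          nlinarith [sq_nonneg (t - 1)]
    have h_inv : (3 : ℝ)⁻¹ ≤ (√(2 * π * (1 : ℝ≥0)))⁻¹ := by
      refine inv_anti₀ (Real.sqrt_pos.2 ?_) h_sqrt
      simp [Real.pi_pos]
    calc rexp (-t ^ 2) / 9 = 3⁻¹ * (rexp (-t ^ 2) / 3) := by ring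
      _ ≤ gaussianPDFReal 0 1 x := by
        rw [gaussianPDFReal]
        gcongr
  calc ENNReal.ofReal (rexp (-t ^ 2) / 9)
      = ∫⁻ _ in Set.Icc t (t + 1), ENNReal.ofReal (rexp (-t ^ 2) / 9) := by simp
    _ ≤ ∫⁻ x in Set.Icc t (t + 1), gaussianPDF 0 1 x :=
        setLIntegral_mono (measurable_gaussianPDF 0 1)
          fun x hx ↦ ENNReal.ofReal_le_ofReal (h_density x hx)
    _ = gaussianReal 0 1 (Set.Icc t (t + 1)) := (gaussianReal_apply 0 one_ne_zero _).symm
    _ ≤ gaussianReal 0 1 (Set.Ici t) := measure_mono Set.Icc_subset_Ici_self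

/-- In positive dimension, the Minkowski functional of a neighborhood of zero attains its Lipschitz
constant on the unit sphere. -/
lemma exists_lipschitzWith_gauge_attained {n : ℕ} (hn : n ≠ 0) {B : Set (Euc n)}
    (hB : Convex ℝ B) (hB₀ : B ∈ nhds 0) :
    ∃ L : ℝ≥0, LipschitzWith L (gauge B) ∧ ∃ x : Euc n, ‖x‖ = 1 ∧ gauge B x = L := by
  have : Nonempty (Fin n) := ⟨⟨0, Nat.pos_of_ne_zero hn⟩⟩
  obtain ⟨x, hx, hmax⟩ := (isCompact_sphere (0 : Euc n) 1).exists_isMaxOn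
    (NormedSpace.sphere_nonempty.2 zero_le_one) (continuous_gauge hB hB₀).continuousOn
  have h_abs : Absorbent ℝ B := absorbent_nhds_zero hB₀
  have h_le (z : Euc n) : gauge B z ≤ gauge B x * ‖z‖ := by
    rcases eq_or_ne z 0 with rfl | hz
    · simp
    have hz' : 0 < ‖z‖ := norm_pos_iff.2 hz
    have h := hmax (a := ‖z‖⁻¹ • z) (by simp [norm_smul, hz'.ne'])
    simp only [Set.mem_ofPred_eq, gauge_smul_of_nonneg (inv_nonneg.2 hz'.le), smul_eq_mul] at h
    rwa [inv_mul_le_iff₀ hz', mul_comm] at h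
  refine ⟨⟨gauge B x, gauge_nonneg x⟩, LipschitzWith.of_le_add_mul _ fun y z ↦ ?_, x,
    by simpa using hx, rfl⟩
  calc gauge B y = gauge B (z + (y - z)) := by simp
    _ ≤ gauge B z + gauge B (y - z) := gauge_add_le hB h_abs _ _
    _ ≤ gauge B z + gauge B x * dist y z := by
      rw [dist_eq_norm]
      gcongr
      exact h_le _

/-- **Critical dimension from small-ball behaviour on lines.** For any `δ > 0` there is
`n₀ = n₀(δ)`, and for any `p ∈ [1,∞)` a constant `c_{δ,p} > 0`, such that: if `n ≥ n₀`
and `B ⊆ ℝⁿ` is an origin-symmetric convex body with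
`P{‖g·x‖_B^p ≥ E‖G‖_B^p} ≤ n^{−δ}` for every unit vector `x`, then
`E‖G‖_B / Lip(‖·‖_B) ≥ c_{δ,p}·√(log n)` (stated via a Lipschitz constant `L` of
`‖·‖_B`, witnessed by its least value). -/
theorem expectation_lower_bound_of_small_ball :
    ∀ δ : ℝ, 0 < δ → ∃ n₀ : ℕ, ∀ p : ℝ, 1 ≤ p → ∃ c : ℝ, 0 < c ∧
      ∀ n : ℕ, n₀ ≤ n → ∀ B : Set (Euc n), IsSymmConvexBody B →
      (∀ x : Euc n, ‖x‖ = 1 →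
        gaussianReal 0 1
            {g : ℝ | (∫ y, gauge B y ^ p ∂stdGaussian n) ≤ gauge B (g • x) ^ p} ≤
          ENNReal.ofReal ((n : ℝ) ^ (-δ))) →
      ∃ L : ℝ≥0, LipschitzWith L (gauge B) ∧
        c * Real.sqrt (Real.log n) * (L : ℝ) ≤ ∫ y, gauge B y ∂stdGaussian n := by
  intro δ hδ
  obtain ⟨N, hN⟩ := Filter.eventually_atTop.1
    (((tendsto_rpow_atTop (half_pos hδ)).comp tendsto_natCast_atTop_atTop).eventually_gt_atTop 9)
  refine ⟨max N 1, fun p hp ↦ ?_⟩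
  have hp0 : 0 < p := by linarith
  obtain ⟨K, hK_pos, hK⟩ := MomentComparison.exists_integral_seminorm_rpow_le hp
  refine ⟨√(δ / 2) / K, by positivity, fun n hn B ⟨hB_compact, hB, hB_int, hB_symm⟩ h_tail ↦ ?_⟩
  have hn_pos : (0 : ℝ) < n := by exact_mod_cast (le_max_right N 1).trans hn
  have hn9 : 9 < (n : ℝ) ^ (δ / 2) := hN n ((le_max_left N 1).trans hn)
  have hB₀ : B ∈ nhds 0 := mem_interior_iff_mem_nhds.1 hB_int
  have h_abs : Absorbent ℝ B := absorbent_nhds_zero hB₀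
  obtain ⟨L, hL, x, hx, hxL⟩ :=
    exists_lipschitzWith_gauge_attained (by exact_mod_cast hn_pos.ne') hB hB₀
  refine ⟨L, hL, ?_⟩
  let q : Seminorm ℝ (Euc n) := Seminorm.of (gauge B) (gauge_add_le hB h_abs) fun r y ↦ by
    rcases le_total 0 r with hr | hr
    · rw [gauge_smul_of_nonneg hr, smul_eq_mul, Real.norm_of_nonneg hr]
    · rw [← gauge_neg hB_symm, ← neg_smul, gauge_smul_of_nonneg (neg_nonneg.2 hr), smul_eq_mul,
        Real.norm_of_nonpos hr]
  have hq_cont : Continuous q := continuous_gauge hB hB₀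
  have h_int : Integrable (gauge B) (ProbabilityTheory.stdGaussian (Euc n)) := by
    refine (IsGaussian.integrable_id.norm.const_mul (L : ℝ)).mono'
      hq_cont.aestronglyMeasurable (Filter.Eventually.of_forall fun y ↦ ?_)
    have h := hL.dist_le_mul y 0
    rwa [gauge_zero, dist_zero_right, dist_zero_right] at h
  have h_moment := hK (Euc n) (ProbabilityTheory.stdGaussian (Euc n))
    integral_id_stdGaussian q hq_cont h_int
  change ∫ y, gauge B y ^ p ∂_ ≤ (K * ∫ y, gauge B y ∂_) ^ p at h_moment
  rw [← stdGaussian_eq_stdGaussian_euc] at h_moment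
  set M := ∫ y, gauge B y ^ p ∂_root_.stdGaussian n
  set I := ∫ y, gauge B y ∂_root_.stdGaussian n
  have hI : 0 ≤ I := integral_nonneg fun y ↦ gauge_nonneg y
  set t := √(δ / 2) * √(Real.log n) with ht
  have ht_sq : t ^ 2 = Real.log n * (δ / 2) := by
    rw [ht, mul_pow, Real.sq_sqrt (by positivity), Real.sq_sqrt (Real.log_natCast_nonneg n),
      mul_comm]
  have h_large : (t * L) ^ p < M := by
    by_contra! h_le
    have h_subset : Set.Ici t ⊆ {g : ℝ | M ≤ gauge B (g • x) ^ p} := by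
      intro g hg
      have hg₀ : 0 ≤ g := (by positivity : 0 ≤ t).trans hg
      refine h_le.trans ?_
      rw [gauge_smul_of_nonneg hg₀, hxL, smul_eq_mul]
      have : t ≤ g := hg
      gcongr
    have h := (ofReal_exp_le_gaussianReal_Ici (by positivity)).trans
      ((measure_mono h_subset).trans (h_tail x hx))
    rw [ENNReal.ofReal_le_ofReal_iff (by positivity), ht_sq, ← mul_neg,
      ← Real.rpow_def_of_pos hn_pos, div_le_iff₀ (by norm_num)] at h
    have h_split : (n : ℝ) ^ (-(δ / 2)) = (n : ℝ) ^ (-δ) * (n : ℝ) ^ (δ / 2) := by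
      rw [← Real.rpow_add hn_pos]
      ring_nf
    rw [h_split] at h
    exact hn9.not_ge (le_of_mul_le_mul_left h (by positivity))
  have h_final : t * L ≤ K * I :=
    (Real.rpow_le_rpow_iff (by positivity) (by positivity) hp0).1 (h_large.le.trans h_moment)
  calc √(δ / 2) / K * √(Real.log n) * L = t * L / K := by rw [ht]; ring
    _ ≤ I := by rwa [div_le_iff₀' hK_pos]
end
end
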